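/- Let k ≥ 3 and r ∈ ℕ. There exists ψ₀ > 0 depending only on r and k such that for every 0 < ψ ≤ ψ₀ there exists n₀ such that the following holds for all n ≥ n₀: for every r-edge-coloured K_n^(k) (call it H), there exists a vertex subset W ⊆ V(H) with n/(5r) ≤ |W| ≤ n/(4r) such that H[W] contains a monochromatic tight cycle of length ℓ for every ℓ ≤ (1−ψ)|W| with ℓ divisible by k. -/

import Mathlib

/-- A vertex set `C` forms a monochromatic tight cycle in the `χ`-edge-coloured complete
`k`-graph on `Fin n`: either `C` is degenerate (at most `k` vertices), or the vertices of `C`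
can be cyclically ordered so that every `k` consecutive vertices form an edge, all of these
edges having the same colour. -/
def MonoTightCycle {n : ℕ} {α : Type*} (k : ℕ) (χ : Finset (Fin n) → α)
    (C : Finset (Fin n)) : Prop :=
  C.card ≤ k ∨
  ∃ (g : ℕ → Fin n) (c : α),
    (∀ i, g (i + C.card) = g i) ∧
    Set.InjOn g (Set.Iio C.card) ∧
    (Finset.range C.card).image g = C ∧
    ∀ i, χ ((Finset.range k).image (fun j => g (i + j))) = c

namespace TightReservoir

open Finset

variable {k n m : ℕ}

/-- The point agreeing with `y` in the first `j` coordinates and with `x` in the others. -/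
def mix (j : ℕ) (y x : Fin k → Fin n) : Fin k → Fin n := fun i => if (i : ℕ) < j then y i else x i

/-- The staircase from `x` to `y`, replacing one coordinate at a time, stays inside `T`. -/
def Step (T : Finset (Fin k → Fin n)) (x y : Fin k → Fin n) : Prop := ∀ j ≤ k, mix j y x ∈ T

instance (T : Finset (Fin k → Fin n)) (x y : Fin k → Fin n) : Decidable (Step T x y) :=
  inferInstanceAs (Decidable (∀ j ≤ k, mix j y x ∈ T))

/-- The values `v` such that replacing the `i`-th coordinate of `x` by `v` gives a point of `T`. -/
def line (T : Finset (Fin k → Fin n)) (i : Fin k) (x : Fin k → Fin n) : Finset (Fin n) :=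
  univ.filter fun v => Function.update x i v ∈ T

/-- Forgetting the `i`-th coordinate. -/
def proj (i : Fin k) (x : Fin k → Fin n) : {j : Fin k // j ≠ i} → Fin n := fun j => x j

/-- The number of axis-parallel lines meeting `T`. -/
def shadowCard (T : Finset (Fin k → Fin n)) : ℕ := ∑ i, (T.image (proj i)).card

@[simp] lemma mix_zero (y x : Fin k → Fin n) : mix 0 y x = x := by
  ext i; simp [mix]

@[simp] lemma mix_self (y x : Fin k → Fin n) : mix k y x = y := by
  ext i; simp [mix]

lemma Step.left {T : Finset (Fin k → Fin n)} {x y : Fin k → Fin n} (h : Step T x y) : x ∈ T := by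
  simpa using h 0 (Nat.zero_le _)

lemma Step.right {T : Finset (Fin k → Fin n)} {x y : Fin k → Fin n} (h : Step T x y) : y ∈ T := by
  simpa using h k le_rfl

lemma Step.mono {T T' : Finset (Fin k → Fin n)} (hT : T ⊆ T') {x y : Fin k → Fin n}
    (h : Step T x y) : Step T' x y := fun j hj => hT (h j hj)

lemma mem_line {T : Finset (Fin k → Fin n)} {i : Fin k} {x : Fin k → Fin n} {v : Fin n} :
    v ∈ line T i x ↔ Function.update x i v ∈ T := by simp [line]

lemma proj_eq_iff {i : Fin k} {x y : Fin k → Fin n} :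
    proj i x = proj i y ↔ Function.update x i (y i) = y := by
  constructor
  · intro h
    ext j
    by_cases hj : j = i
    · subst hj; simp
    · have := congrFun h ⟨j, hj⟩
      simp only [proj] at this
      simp [hj, this]
  · intro h
    ext j
    have := congrFun h j.1
    rw [Function.update_of_ne j.2] at this
    simp [proj, this]

lemma line_congr (T : Finset (Fin k → Fin n)) {i : Fin k} {x y : Fin k → Fin n}
    (h : proj i x = proj i y) : line T i x = line T i y := by
  ext v
  rw [mem_line, mem_line, ← proj_eq_iff.1 h, Function.update_idem]

lemma card_filter_proj (T : Finset (Fin k → Fin n)) (i : Fin k) (x : Fin k → Fin n) :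
    (T.filter fun y => proj i y = proj i x).card = (line T i x).card := by
  refine Finset.card_bij (fun y _ => y i) ?_ ?_ ?_
  · intro y hy
    rw [mem_filter] at hy
    rw [mem_line, proj_eq_iff.1 hy.2.symm]
    exact hy.1
  · intro y hy z hz hyz
    rw [mem_filter] at hy hz
    rw [← proj_eq_iff.1 hy.2.symm, ← proj_eq_iff.1 hz.2.symm, hyz]
  · intro v hv
    rw [mem_line] at hv
    refine ⟨Function.update x i v, ?_, by simp⟩
    rw [mem_filter]
    refine ⟨hv, ?_⟩
    rw [proj_eq_iff]; simp

lemma card_proj (i : Fin k) (T : Finset (Fin k → Fin n)) :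
    (T.image (proj i)).card ≤ n ^ (k - 1) := by
  refine (Finset.card_le_univ _).trans ?_
  simp [Fintype.card_subtype_compl]

lemma shadowCard_le (T : Finset (Fin k → Fin n)) : shadowCard T ≤ k * n ^ (k - 1) := by
  unfold shadowCard
  refine (Finset.sum_le_sum fun i _ => card_proj i T).trans ?_
  simp

lemma shadowCard_mono {S T : Finset (Fin k → Fin n)} (h : S ⊆ T) :
    shadowCard S ≤ shadowCard T :=
  Finset.sum_le_sum fun _ _ => card_le_card (image_subset_image h)

lemma shadowCard_pos {T : Finset (Fin k → Fin n)} (hk : 0 < k) (h : T.Nonempty) :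
    0 < shadowCard T := by
  unfold shadowCard
  refine Finset.sum_pos (fun i _ => ?_) ⟨⟨0, hk⟩, mem_univ _⟩
  exact (h.image _).card_pos

lemma exists_remove_line {T : Finset (Fin k → Fin n)} {x : Fin k → Fin n} (hx : x ∈ T)
    (i : Fin k) : ∃ S ⊆ T, S.card + (line T i x).card = T.card ∧
      shadowCard S + 1 ≤ shadowCard T := by
  refine ⟨T.filter fun y => ¬ proj i y = proj i x, filter_subset _ _, ?_, ?_⟩
  · rw [← card_filter_proj, add_comm]
    exact card_filter_add_card_filter_not _
  · refine Nat.succ_le_of_lt (Finset.sum_lt_sum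
      (fun j _ => card_le_card (image_subset_image (filter_subset _ _))) ⟨i, mem_univ _, ?_⟩)
    apply card_lt_card
    refine Finset.ssubset_iff_subset_ne.2 ⟨image_subset_image (filter_subset _ _), fun h => ?_⟩
    have : proj i x ∈ T.image (proj i) := mem_image_of_mem _ hx
    rw [← h, mem_image] at this
    obtain ⟨y, hy, hxy⟩ := this
    exact (mem_filter.1 hy).2 hxy

lemma mul_card_le_of_fibers {α β : Type*} [DecidableEq α] [DecidableEq β]
    {A : Finset α} {B : Finset β} {d : ℝ}
    (f : α → β) (h : ∀ b ∈ B, d ≤ ((A.filter fun a => f a = b).card : ℝ)) :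
    d * B.card ≤ A.card := by
  have h1 : ∑ b ∈ B, (A.filter fun a => f a = b).card ≤ A.card := by
    rw [← Finset.card_biUnion]
    · exact card_le_card (biUnion_subset.2 fun b _ => filter_subset _ _)
    · intro b _ c _ hbc
      rw [Function.onFun, Finset.disjoint_left]
      intro a ha ha'
      exact hbc ((mem_filter.1 ha).2.symm.trans (mem_filter.1 ha').2)
  calc d * B.card = ∑ b ∈ B, d := by simp [mul_comm]
    _ ≤ ∑ b ∈ B, ((A.filter fun a => f a = b).card : ℝ) := Finset.sum_le_sum h
    _ ≤ A.card := by exact_mod_cast h1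

/-- A set can be thinned out so that every line meeting it meets it in at least `d` points. -/
lemma exists_clean (T : Finset (Fin k → Fin n)) {d : ℝ} (hd : 0 ≤ d) :
    ∃ S ⊆ T, (∀ x ∈ S, ∀ i, d ≤ (line S i x).card) ∧
      (T.card : ℝ) - d * (k * n ^ (k - 1)) ≤ S.card := by
  obtain ⟨S, hS, hmax⟩ := Finset.exists_max_image T.powerset
    (fun S => (S.card : ℝ) - d * shadowCard S) ⟨∅, by simp⟩
  rw [mem_powerset] at hS
  refine ⟨S, hS, fun x hx i => ?_, ?_⟩
  · obtain ⟨R, hR, h1, h2⟩ := exists_remove_line hx i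
    have h3 := hmax R (mem_powerset.2 (hR.trans hS))
    have h4 : (R.card : ℝ) + (line S i x).card = S.card := by exact_mod_cast h1
    have h5 : (shadowCard R : ℝ) + 1 ≤ shadowCard S := by exact_mod_cast h2
    nlinarith
  · have h3 := hmax T (mem_powerset.2 le_rfl)
    have h4 : (shadowCard T : ℝ) ≤ k * n ^ (k - 1) := by exact_mod_cast shadowCard_le T
    have h5 : (0 : ℝ) ≤ d * shadowCard S := by positivity
    have := mul_le_mul_of_nonneg_left h4 hd
    linarith

lemma mix_succ (j : Fin k) (y x : Fin k → Fin n) :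
    mix (j + 1) y x = Function.update (mix j y x) j (y j) := by
  ext i
  rcases lt_trichotomy i j with h | h | h
  · have h' : (i : ℕ) < j := h
    simp [mix, h.ne, h', Nat.lt_succ_of_lt h']
  · subst h; simp [mix]
  · have h' : (j : ℕ) < i := h
    have h1 : ¬ (i : ℕ) < j + 1 := by omega
    have h2 : ¬ (i : ℕ) < j := by omega
    simp [mix, h.ne', h1, h2]

/-- In a set whose lines are all long, every point has many successors avoiding a given set. -/
lemma pow_le_card_step {T : Finset (Fin k → Fin n)} {d : ℝ} (hd : 0 ≤ d) (U : Finset (Fin n))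
    (hT : ∀ x ∈ T, ∀ i, d + U.card ≤ (line T i x).card) {x : Fin k → Fin n} (hx : x ∈ T) :
    d ^ k ≤ ((univ.filter fun y => Step T x y ∧ ∀ i, y i ∉ U).card : ℝ) := by
  classical
  have key : ∀ j ≤ k, d ^ j ≤ ((univ.filter fun y : Fin k → Fin n =>
      (∀ i : Fin k, j ≤ i → y i = x i) ∧ (∀ i : Fin k, (i : ℕ) < j → y i ∉ U) ∧
      ∀ j' ≤ j, mix j' y x ∈ T).card : ℝ) := by
    intro j
    induction j with
    | zero =>
      intro _
      rw [pow_zero]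
      exact Nat.one_le_cast.2 (Finset.card_pos.2 ⟨x, by simp [hx]⟩)
    | succ j ih =>
      intro hj
      have ih := ih (by omega)
      let i : Fin k := ⟨j, by omega⟩
      rw [pow_succ, mul_comm]
      refine (mul_le_mul_of_nonneg_left ih hd).trans ?_
      refine mul_card_le_of_fibers (fun y => Function.update y i (x i)) fun y hy => ?_
      rw [mem_filter] at hy
      obtain ⟨-, hy1, hy2, hy3⟩ := hy
      have hm : mix j y x ∈ T := hy3 j le_rfl
      have hc : d ≤ ((line T i (mix j y x) \ U).card : ℝ) := by
        have h1 := hT _ hm i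
        have h2 := Finset.le_card_sdiff U (line T i (mix j y x))
        have h3 : ((line T i (mix j y x)).card : ℝ) ≤
            (line T i (mix j y x) \ U).card + U.card := by exact_mod_cast (by omega)
        linarith
      refine hc.trans ?_
      have hinj : Function.Injective fun v => Function.update y i v := Function.update_injective y i
      rw [← Finset.card_image_of_injective _ hinj]
      refine Nat.cast_le.2 (card_le_card ?_)
      intro z hz
      rw [mem_image] at hz
      obtain ⟨v, hv, rfl⟩ := hz
      rw [mem_sdiff, mem_line] at hv
      have hmj : ∀ j' ≤ j, mix j' (Function.update y i v) x = mix j' y x := by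
        intro j' hj'
        ext l
        by_cases hl : l = i
        · subst hl; simp [mix, i, Nat.not_lt.2 hj']
        · simp [mix, hl]
      rw [mem_filter, mem_filter]
      refine ⟨⟨mem_univ _, ?_, ?_, ?_⟩, ?_⟩
      · intro l hl
        have : l ≠ i := by rintro rfl; simp [i] at hl
        rw [Function.update_of_ne this]
        exact hy1 l (by omega)
      · intro l hl
        by_cases h : l = i
        · subst h; simpa using hv.2
        · rw [Function.update_of_ne h]
          have : (l : ℕ) ≠ j := fun h' => h (Fin.ext h')
          exact hy2 l (by omega)
      · intro j' hj'
        rcases Nat.lt_succ_iff_lt_or_eq.1 (Nat.lt_succ_of_le hj') with h | h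
        · rw [hmj j' (by omega)]; exact hy3 j' (by omega)
        · subst h
          have := mix_succ i (Function.update y i v) x
          simp only [i] at this
          rw [this, hmj j le_rfl]
          simpa [i] using hv.1
      · have : x i = y i := (hy1 i le_rfl).symm
        simp [this]
  refine (key k le_rfl).trans ?_
  refine Nat.cast_le.2 (card_le_card fun y hy => ?_)
  rw [mem_filter] at hy ⊢
  exact ⟨hy.1, hy.2.2.2, fun i => hy.2.2.1 i i.2⟩

lemma mix_comp_rev {j : ℕ} (hj : j ≤ k) (y x : Fin k → Fin n) :
    mix j y x ∘ Fin.rev = mix (k - j) (x ∘ Fin.rev) (y ∘ Fin.rev) := by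
  ext i
  by_cases h : (i : ℕ) < k - j
  · have : ¬ (Fin.rev i : ℕ) < j := by rw [Fin.val_rev]; omega
    simp only [mix, Function.comp_apply, this, h, if_true, if_false]
  · have : (Fin.rev i : ℕ) < j := by rw [Fin.val_rev]; omega
    simp only [mix, Function.comp_apply, this, h, if_true, if_false]

lemma comp_rev_rev (x : Fin k → Fin n) : (x ∘ Fin.rev) ∘ Fin.rev = x := by
  ext i; simp

/-- In a set whose lines are all long, every point has many predecessors. -/
lemma pow_le_card_step_left {T : Finset (Fin k → Fin n)} {d : ℝ} (hd : 0 ≤ d)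
    (hT : ∀ x ∈ T, ∀ i, d ≤ (line T i x).card) {y : Fin k → Fin n} (hy : y ∈ T) :
    d ^ k ≤ ((univ.filter fun s => Step T s y).card : ℝ) := by
  have hinj : Function.Injective fun x : Fin k → Fin n => x ∘ Fin.rev := fun a b h => by
    rw [← comp_rev_rev a, ← comp_rev_rev b]; exact congrArg (· ∘ Fin.rev) h
  have hmem : ∀ x, x ∈ T.image (· ∘ Fin.rev) ↔ x ∘ Fin.rev ∈ T := fun x => by
    rw [mem_image]
    constructor
    · rintro ⟨z, hz, rfl⟩; rwa [comp_rev_rev]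
    · intro h; exact ⟨_, h, comp_rev_rev x⟩
  have h := pow_le_card_step (T := T.image (· ∘ Fin.rev)) hd ∅ (fun x hx i => ?_)
    ((hmem _).2 (by rwa [comp_rev_rev y]))
  · refine h.trans (Nat.cast_le.2 ?_)
    rw [← card_image_of_injective _ hinj]
    refine card_le_card fun s hs => ?_
    rw [mem_image] at hs
    obtain ⟨z, hz, rfl⟩ := hs
    rw [mem_filter] at hz ⊢
    refine ⟨mem_univ _, fun j hj => ?_⟩
    have := hz.2.1 (k - j) (by omega)
    rw [hmem, mix_comp_rev (by omega), comp_rev_rev] at this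
    rwa [show k - (k - j) = j by omega] at this
  · have h1 := hT _ ((hmem x).1 hx) (Fin.rev i)
    have : line (T.image (· ∘ Fin.rev)) i x = line T (Fin.rev i) (x ∘ Fin.rev) := by
      ext v
      rw [mem_line, mem_line, hmem]
      have : Function.update x i v ∘ Fin.rev = Function.update (x ∘ Fin.rev) (Fin.rev i) v := by
        ext l
        by_cases h : l = Fin.rev i
        · subst h; simp
        · have : Fin.rev l ≠ i := fun h' => h (by rw [← h', Fin.rev_rev])
          simp [h, this]
      rw [this]
    rw [this]
    simpa using h1

/-- Two parts of `T` without common lines can only be separated by deleting many points. -/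
def CutRobust (T : Finset (Fin k → Fin n)) : Prop :=
  ∀ S ⊆ T, ∀ R ⊆ T, (∀ i, Disjoint (S.image (proj i)) (R.image (proj i))) →
    (S.card : ℝ) * R.card ≤ n ^ k * ((T.card : ℝ) - S.card - R.card)

lemma card_le_pow (T : Finset (Fin k → Fin n)) : (T.card : ℝ) ≤ (n : ℝ) ^ k := by
  have := Finset.card_le_univ T
  simp only [Fintype.card_pi, Fintype.card_fin, prod_const, card_univ] at this
  exact_mod_cast this

lemma exists_core (hk : 0 < k) {X : Finset (Fin k → Fin n)} (hX : X.Nonempty) :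
    ∃ T ⊆ X, T.Nonempty ∧
      (X.card : ℝ) * shadowCard T ≤ 2 * T.card * (k * n ^ (k - 1)) ∧
      (∀ x ∈ T, ∀ i, (X.card : ℝ) ≤ 4 * (k * n ^ (k - 1)) * (line T i x).card) ∧
      CutRobust T := by
  set N : ℝ := (n : ℝ) ^ k with hN
  set F : ℝ → ℝ := fun a => a * (2 * N - a) with hF
  obtain ⟨T, hT, hmax⟩ := Finset.exists_max_image (X.powerset.filter Finset.Nonempty)
    (fun T => F T.card / shadowCard T) ⟨X, by simp [hX]⟩
  rw [mem_filter, mem_powerset] at hT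
  obtain ⟨hTX, hTne⟩ := hT
  have hDT : (0 : ℝ) < shadowCard T := by exact_mod_cast shadowCard_pos hk hTne
  have hext : ∀ S ⊆ X, F S.card * shadowCard T ≤ F T.card * shadowCard S := by
    intro S hS
    rcases S.eq_empty_or_nonempty with rfl | hne
    · simp [hF, shadowCard]
    · have hDS : (0 : ℝ) < shadowCard S := by exact_mod_cast shadowCard_pos hk hne
      have := hmax S (by simp [hS, hne])
      rwa [div_le_div_iff₀ hDS hDT] at this
  have hTN : (T.card : ℝ) ≤ N := card_le_pow T
  have hXN : (X.card : ℝ) ≤ N := card_le_pow X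
  have hT0 : (0 : ℝ) < T.card := by exact_mod_cast hTne.card_pos
  have hN0 : 0 < N := hT0.trans_le hTN
  have h1 : (X.card : ℝ) * shadowCard T ≤ 2 * T.card * (k * n ^ (k - 1)) := by
    have ha := hext X le_rfl
    have hb : (X.card : ℝ) * N ≤ F X.card := by simp only [hF]; nlinarith
    have hc : F T.card ≤ 2 * N * T.card := by simp only [hF]; nlinarith
    have hd : (shadowCard X : ℝ) ≤ k * n ^ (k - 1) := by exact_mod_cast shadowCard_le X
    have he : N * ((X.card : ℝ) * shadowCard T) ≤ N * (2 * T.card * (k * n ^ (k - 1))) := by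
      calc N * ((X.card : ℝ) * shadowCard T) = (X.card * N) * shadowCard T := by ring
        _ ≤ F X.card * shadowCard T := by gcongr
        _ ≤ F T.card * shadowCard X := ha
        _ ≤ 2 * N * T.card * (k * n ^ (k - 1)) := by gcongr
        _ = _ := by ring
    exact le_of_mul_le_mul_left he hN0
  refine ⟨T, hTX, hTne, h1, fun x hx i => ?_, fun S hS R hR hSR => ?_⟩
  · obtain ⟨S, hS, hc, hs⟩ := exists_remove_line hx i
    have ha := hext S (hS.trans hTX)
    have hc' : (S.card : ℝ) + (line T i x).card = T.card := by exact_mod_cast hc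
    have hs' : (shadowCard S : ℝ) ≤ shadowCard T - 1 := by
      have : (shadowCard S : ℝ) + 1 ≤ shadowCard T := by exact_mod_cast hs
      linarith
    set d : ℝ := ((line T i x).card : ℝ)
    have hS0 : (0 : ℝ) ≤ S.card := by positivity
    have hd0 : 0 ≤ d := by positivity
    have hFT : N * T.card ≤ F T.card := by simp only [hF]; nlinarith
    have hF0 : 0 ≤ F T.card := le_trans (by positivity) hFT
    have hb : F T.card ≤ (F T.card - F S.card) * shadowCard T := by
      have := mul_le_mul_of_nonneg_left hs' hF0
      linarith
    have he : F T.card - F S.card ≤ 2 * N * d := by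
      simp only [hF]; rw [← hc']; nlinarith
    have hf : N * T.card ≤ N * (2 * d * shadowCard T) := by
      calc N * T.card ≤ (F T.card - F S.card) * shadowCard T := hFT.trans hb
        _ ≤ (2 * N * d) * shadowCard T := by gcongr
        _ = _ := by ring
    have hg := le_of_mul_le_mul_left hf hN0
    have hK : (0 : ℝ) ≤ k * n ^ (k - 1) := by positivity
    refine le_of_mul_le_mul_right (h1.trans ?_) hDT
    nlinarith
  · have ha := hext S (hS.trans hTX)
    have hb := hext R (hR.trans hTX)
    have hc : (shadowCard S : ℝ) + shadowCard R ≤ shadowCard T := by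
      have : shadowCard S + shadowCard R ≤ shadowCard T := by
        unfold shadowCard
        rw [← Finset.sum_add_distrib]
        refine Finset.sum_le_sum fun i _ => ?_
        rw [← card_union_of_disjoint (hSR i)]
        exact card_le_card (union_subset (image_subset_image hS) (image_subset_image hR))
      exact_mod_cast this
    have hFT : N * T.card ≤ F T.card := by simp only [hF]; nlinarith
    have hF0 : 0 ≤ F T.card := le_trans (by positivity) hFT
    have hd : (F S.card + F R.card) * shadowCard T ≤ F T.card * shadowCard T := by
      have := mul_le_mul_of_nonneg_left hc hF0
      linarith
    have he := le_of_mul_le_mul_right hd hDT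
    simp only [hF] at he
    have hSR' : (S.card : ℝ) + R.card ≤ T.card := by
      have hdis : Disjoint S R := by
        rw [Finset.disjoint_left]
        intro x hxS hxR
        exact Finset.disjoint_left.1 (hSR ⟨0, hk⟩) (mem_image_of_mem _ hxS) (mem_image_of_mem _ hxR)
      have := card_le_card (union_subset hS hR)
      rw [card_union_of_disjoint hdis] at this
      exact_mod_cast this
    have hS0 : (0 : ℝ) ≤ S.card := by positivity
    have hR0 : (0 : ℝ) ≤ R.card := by positivity
    nlinarith

/-- Few points of `S` lie on a line meeting `S` in few points. -/
lemma card_thin_le (S : Finset (Fin k → Fin n)) {γ : ℝ} (hγ : 0 ≤ γ) :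
    ((S.filter fun x => ∃ i, ((line S i x).card : ℝ) < γ).card : ℝ) ≤ γ * (k * n ^ (k - 1)) := by
  have h1 : ∀ i, ((S.filter fun x => ((line S i x).card : ℝ) < γ).card : ℝ) ≤
      γ * n ^ (k - 1) := by
    intro i
    have : ∀ b ∈ (S.filter fun x => ((line S i x).card : ℝ) < γ).image (proj i),
        (((S.filter fun x => ((line S i x).card : ℝ) < γ).filter fun x => proj i x = b).card : ℝ)
          ≤ γ := by
      intro b hb
      rw [mem_image] at hb
      obtain ⟨x, hx, rfl⟩ := hb
      rw [mem_filter] at hx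
      refine le_trans ?_ hx.2.le
      rw [← card_filter_proj]
      exact Nat.cast_le.2 (card_le_card (filter_subset_filter _ (filter_subset _ _)))
    rw [card_eq_sum_card_image (proj i), Nat.cast_sum]
    refine (Finset.sum_le_sum this).trans ?_
    rw [sum_const, nsmul_eq_mul, mul_comm]
    have h2 : (((S.filter fun x => ((line S i x).card : ℝ) < γ).image (proj i)).card : ℝ) ≤
        n ^ (k - 1) := by exact_mod_cast card_proj i _
    exact mul_le_mul_of_nonneg_left h2 hγ
  have h2 : (S.filter fun x => ∃ i, ((line S i x).card : ℝ) < γ) ⊆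
      univ.biUnion fun i => S.filter fun x => ((line S i x).card : ℝ) < γ := by
    intro x hx
    rw [mem_filter] at hx
    obtain ⟨hx, i, hi⟩ := hx
    exact mem_biUnion.2 ⟨i, mem_univ _, mem_filter.2 ⟨hx, hi⟩⟩
  have h3 : ((S.filter fun x => ∃ i, ((line S i x).card : ℝ) < γ).card : ℝ) ≤
      ∑ i : Fin k, ((S.filter fun x => ((line S i x).card : ℝ) < γ).card : ℝ) := by
    exact_mod_cast (card_le_card h2).trans card_biUnion_le
  refine h3.trans ((Finset.sum_le_sum fun i _ => h1 i).trans ?_)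
  simp only [sum_const, card_univ, Fintype.card_fin, nsmul_eq_mul]
  apply le_of_eq; ring

/-- The points `x` for which both fillings of the `i`-th coordinate land in prescribed sets. -/
def fork (S R : Finset (Fin k → Fin n)) (i : Fin k) (pq : Fin n × Fin n) :
    Finset (Fin k → Fin n) :=
  univ.filter fun x => Function.update x i pq.1 ∈ S ∧ Function.update x i pq.2 ∈ R

lemma mix_update_update (i : Fin k) (j : ℕ) (y x : Fin k → Fin n) (q p : Fin n) :
    mix j (Function.update y i q) (Function.update x i p) =
      Function.update (mix j y x) i (if (i : ℕ) < j then q else p) := by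
  ext l
  by_cases h : l = i
  · subst h; simp [mix]
  · simp [mix, h]

lemma fork_sum_card {S R : Finset (Fin k → Fin n)} {i : Fin k} {g : ℝ}
    {Y : Finset (Fin k → Fin n)} (hY : Y ⊆ R) (hg : ∀ y ∈ Y, g ≤ (line S i y).card) :
    g * n * Y.card ≤ ∑ pq, ((fork S R i pq).card : ℝ) := by
  have h0 : ∑ pq, ((fork S R i pq).card : ℝ) = ((univ.sigma (fork S R i)).card : ℝ) := by
    rw [card_sigma, Nat.cast_sum]
  rw [h0]
  refine mul_card_le_of_fibers (fun t => Function.update t.2 i t.1.2) fun y hy => ?_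
  have h1 : ((line S i y ×ˢ (univ : Finset (Fin n))).card : ℝ) = (line S i y).card * n := by
    rw [card_product]; simp
  have h2 : g * n ≤ ((line S i y ×ˢ (univ : Finset (Fin n))).card : ℝ) := by
    rw [h1]; exact mul_le_mul_of_nonneg_right (hg y hy) (by positivity)
  refine h2.trans (Nat.cast_le.2 ?_)
  refine card_le_card_of_injOn (fun pv => ⟨(pv.1, y i), Function.update y i pv.2⟩) ?_ ?_
  · rintro ⟨p, v⟩ h
    simp only [coe_product, coe_univ, Set.mem_prod, mem_coe, mem_line] at h
    simp [fork, h.1, hY hy]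
  · rintro ⟨p, v⟩ _ ⟨p', v'⟩ _ h
    simp only [Sigma.mk.injEq, Prod.mk.injEq, and_true, heq_eq_eq] at h
    have := congrFun h.2 i
    simp only [Function.update_self] at this
    rw [h.1, this]

lemma expansion_of_thick {S T : Finset (Fin k → Fin n)} (hn : 0 < n) (hST : S ⊆ T)
    (hk : 0 < k) (i : Fin k) {γ : ℝ} (hγ : 0 < γ) {Y : Finset (Fin k → Fin n)} (hY : Y ⊆ T \ S)
    (hg : ∀ y ∈ Y, γ * n ≤ (line S i y).card) (hYc : γ / k * n ^ k ≤ Y.card) :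
    γ ^ 2 / (2 * k) * (γ ^ 2 / (2 * k ^ 2)) ^ k * ((n : ℝ) ^ k) ^ 2 ≤
      (((S ×ˢ (T \ S)).filter fun p => Step T p.1 p.2).card : ℝ) := by
  set θ : ℝ := γ ^ 2 / (2 * k ^ 2) with hθ
  have hk' : (0 : ℝ) < k := by exact_mod_cast hk
  have hn' : (0 : ℝ) < n := by exact_mod_cast hn
  have hθ0 : 0 < θ := by positivity
  choose G hGsub hGline hGcard using fun pq : Fin n × Fin n =>
    exists_clean (fork S (T \ S) i pq) (d := θ * n) (by positivity)
  have hnk : (n : ℝ) ^ k = n * n ^ (k - 1) := by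
    rw [← pow_succ', Nat.sub_add_cancel hk]
  have hG : γ ^ 2 / (2 * k) * n ^ (k + 2) ≤ ((univ.sigma G).card : ℝ) := by
    rw [card_sigma, Nat.cast_sum]
    have h1 := fork_sum_card hY hg
    have h2 : ∑ pq, (((fork S (T \ S) i pq).card : ℝ) - θ * n * (k * n ^ (k - 1))) ≤
        ∑ pq, ((G pq).card : ℝ) := Finset.sum_le_sum fun pq _ => hGcard pq
    refine le_trans ?_ h2
    rw [Finset.sum_sub_distrib]
    simp only [sum_const, card_univ, Fintype.card_prod, Fintype.card_fin, nsmul_eq_mul,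
      Nat.cast_mul]
    have h3 : γ * n * n * (γ / k * n ^ k) ≤ γ * n * n * Y.card := by gcongr
    have h4 : γ * n * n * (γ / k * n ^ k) = γ ^ 2 / k * n ^ (k + 2) := by
      rw [pow_add]; field_simp
    have h5 : (n : ℝ) * n * (θ * n * (k * n ^ (k - 1))) = γ ^ 2 / (2 * k) * n ^ (k + 2) := by
      rw [pow_add, hnk, hθ]; field_simp
    have h6 : γ ^ 2 / k * (n : ℝ) ^ (k + 2) = 2 * (γ ^ 2 / (2 * k) * n ^ (k + 2)) := by
      field_simp
    linarith
  set Q := (univ.sigma G).sigma fun t => univ.filter fun y => Step (G t.1) t.2 y with hQ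
  have hQc : (θ * n) ^ k * (γ ^ 2 / (2 * k) * n ^ (k + 2)) ≤ (Q.card : ℝ) := by
    rw [hQ, card_sigma, Nat.cast_sum]
    calc (θ * n) ^ k * (γ ^ 2 / (2 * k) * n ^ (k + 2))
        ≤ (θ * n) ^ k * ((univ.sigma G).card : ℝ) := by gcongr
      _ = ∑ t ∈ univ.sigma G, (θ * n) ^ k := by simp [mul_comm]
      _ ≤ _ := Finset.sum_le_sum fun t ht => ?_
    rw [mem_sigma] at ht
    simpa using pow_le_card_step (d := θ * n) (by positivity) ∅
      (by simpa using hGline t.1) ht.2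
  have hinj : Q.card ≤ (((S ×ˢ (T \ S)).filter fun p => Step T p.1 p.2) ×ˢ
      (univ : Finset (Fin n × Fin n))).card := by
    refine card_le_card_of_injOn (fun t => ((Function.update t.1.2 i t.1.1.1,
      Function.update t.2 i t.1.1.2), (t.1.2 i, t.2 i))) ?_ ?_
    · rintro ⟨⟨⟨p, q⟩, x⟩, y⟩ h
      simp only [hQ, mem_coe, mem_sigma, mem_univ, true_and, mem_filter] at h
      obtain ⟨hx, hxy⟩ := h
      have hf : ∀ z ∈ G (p, q), Function.update z i p ∈ S ∧ Function.update z i q ∈ T \ S :=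
        fun z hz => (mem_filter.1 (hGsub _ hz)).2
      simp only [mem_coe, mem_product, mem_filter, mem_univ, and_true]
      refine ⟨⟨(hf x hx).1, (hf y hxy.right).2⟩, fun j hj => ?_⟩
      rw [mix_update_update]
      split_ifs
      · exact sdiff_subset (hf _ (hxy j hj)).2
      · exact hST (hf _ (hxy j hj)).1
    · rintro ⟨⟨⟨p, q⟩, x⟩, y⟩ _ ⟨⟨⟨p', q'⟩, x'⟩, y'⟩ _ h
      simp only [Prod.mk.injEq] at h
      obtain ⟨⟨h1, h2⟩, h3, h4⟩ := h
      have hp := congrFun h1 i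
      have hq := congrFun h2 i
      simp only [Function.update_self] at hp hq
      have hx : x = x' := by
        have := congrArg (fun z => Function.update z i (x i)) h1
        simp only [Function.update_idem] at this
        rwa [Function.update_eq_self, h3, Function.update_eq_self] at this
      have hy : y = y' := by
        have := congrArg (fun z => Function.update z i (y i)) h2
        simp only [Function.update_idem] at this
        rwa [Function.update_eq_self, h4, Function.update_eq_self] at this
      subst hp hq hx hy
      rfl
  rw [card_product] at hinj
  simp only [card_univ, Fintype.card_prod, Fintype.card_fin] at hinj
  have hinj' : (Q.card : ℝ) ≤
      (((S ×ˢ (T \ S)).filter fun p => Step T p.1 p.2).card : ℝ) * (n * n) := by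
    exact_mod_cast hinj
  have h := hQc.trans hinj'
  have hnn : (0 : ℝ) < n * n := by positivity
  refine le_of_mul_le_mul_right (le_trans (le_of_eq ?_) h) hnn
  rw [mul_pow, pow_add]; ring

lemma expansion (hk : 0 < k) {α : ℝ} (hα : 0 < α) : ∃ c : ℝ, 0 < c ∧
    ∀ (n : ℕ) (T : Finset (Fin k → Fin n)), 0 < n → CutRobust T → ∀ S ⊆ T,
      α * n ^ k ≤ S.card → α * n ^ k ≤ ((T \ S).card : ℝ) →
      c * ((n : ℝ) ^ k) ^ 2 ≤ (((S ×ˢ (T \ S)).filter fun p => Step T p.1 p.2).card : ℝ) := by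
  have hk' : (0 : ℝ) < k := by exact_mod_cast hk
  set γ : ℝ := α ^ 2 / (8 * (k + 1)) with hγ
  have hγ0 : 0 < γ := by positivity
  refine ⟨γ ^ 2 / (2 * k) * (γ ^ 2 / (2 * k ^ 2)) ^ k, by positivity, ?_⟩
  intro n T hn hcut S hST hS hR
  have hn' : (0 : ℝ) < n := by exact_mod_cast hn
  set N : ℝ := (n : ℝ) ^ k with hN
  have hN0 : 0 < N := by positivity
  have hnk : N = n * n ^ (k - 1) := by
    rw [hN, ← pow_succ', Nat.sub_add_cancel hk]
  have hα1 : α ≤ 1 := by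
    have := hS.trans (card_le_pow S)
    rw [← hN] at this
    by_contra h
    nlinarith
  set Y : Fin k → Finset (Fin k → Fin n) := fun i =>
    (T \ S).filter fun y => γ * n ≤ ((line S i y).card : ℝ) with hY
  by_cases hex : ∃ i, γ / k * N ≤ (Y i).card
  · obtain ⟨i, hi⟩ := hex
    exact expansion_of_thick hn hST hk i hγ0 (filter_subset _ _)
      (fun y hy => (mem_filter.1 hy).2) hi
  exfalso
  push Not at hex
  set A := S.filter fun x => ∃ i, ((line S i x).card : ℝ) < γ * n with hA
  set B := univ.biUnion Y with hB
  have hAc : (A.card : ℝ) ≤ k * γ * N := by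
    refine (card_thin_le S (γ := γ * n) (by positivity)).trans (le_of_eq ?_)
    rw [hnk]; ring
  have hBc : (B.card : ℝ) ≤ γ * N := by
    have h1 : (B.card : ℝ) ≤ ∑ i, ((Y i).card : ℝ) := by exact_mod_cast card_biUnion_le
    refine h1.trans ((Finset.sum_le_sum fun i _ => (hex i).le).trans (le_of_eq ?_))
    simp only [sum_const, card_univ, Fintype.card_fin, nsmul_eq_mul]
    field_simp
  have hAS : A ⊆ S := filter_subset _ _
  have hBR : B ⊆ T \ S := biUnion_subset.2 fun i _ => filter_subset _ _
  have hSA := card_sdiff_add_card_eq_card hAS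
  have hRB := card_sdiff_add_card_eq_card hBR
  have hTS := card_sdiff_add_card_eq_card hST
  have hSA' : ((S \ A).card : ℝ) + A.card = S.card := by exact_mod_cast hSA
  have hRB' : (((T \ S) \ B).card : ℝ) + B.card = (T \ S).card := by exact_mod_cast hRB
  have hTS' : ((T \ S).card : ℝ) + S.card = T.card := by exact_mod_cast hTS
  have hc := hcut (S \ A) (sdiff_subset.trans hST) ((T \ S) \ B)
    (sdiff_subset.trans sdiff_subset) (fun i => by
      rw [Finset.disjoint_left]
      intro b hb hb'
      rw [mem_image] at hb hb'
      obtain ⟨x, hx, rfl⟩ := hb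
      obtain ⟨y, hy, hxy⟩ := hb'
      rw [mem_sdiff] at hx hy
      have hx2 : γ * n ≤ ((line S i x).card : ℝ) := by
        by_contra h
        exact hx.2 (mem_filter.2 ⟨hx.1, i, not_le.1 h⟩)
      refine hy.2 (mem_biUnion.2 ⟨i, mem_univ _, mem_filter.2 ⟨hy.1, ?_⟩⟩)
      rwa [line_congr S hxy])
  rw [← hN] at hc
  have hγk : (k + 1) * γ = α ^ 2 / 8 := by rw [hγ]; field_simp
  have hkγ : 0 < k * γ := by positivity
  have h1 : α / 2 * N ≤ (S \ A).card := by nlinarith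
  have h2 : α / 2 * N ≤ ((T \ S) \ B).card := by nlinarith
  have h3 : (α / 2 * N) * (α / 2 * N) ≤ N * ((k + 1) * γ * N) := by
    calc (α / 2 * N) * (α / 2 * N) ≤ ((S \ A).card : ℝ) * ((T \ S) \ B).card := by gcongr
      _ ≤ _ := hc
      _ ≤ _ := by gcongr; linarith
  rw [hγk] at h3
  have : 0 < α ^ 2 * N ^ 2 := by positivity
  nlinarith

/-- The walks from `x` to `y` with `m` intermediate points. -/
def walks (T : Finset (Fin k → Fin n)) (x y : Fin k → Fin n) (m : ℕ) :
    Finset (Fin m → Fin k → Fin n) :=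
  univ.filter fun z => List.IsChain (Step T) (x :: (List.ofFn z ++ [y]))

lemma ofFn_snoc {α : Type*} {m : ℕ} (z : Fin m → α) (s : α) :
    List.ofFn (Fin.snoc z s : Fin (m + 1) → α) = List.ofFn z ++ [s] := by
  rw [List.ofFn_succ', List.concat_eq_append]
  simp

lemma snoc_mem_walks {T : Finset (Fin k → Fin n)} {x s y : Fin k → Fin n} {m : ℕ}
    {z : Fin m → Fin k → Fin n} (hz : z ∈ walks T x s m) (h : Step T s y) :
    (Fin.snoc z s : Fin (m + 1) → Fin k → Fin n) ∈ walks T x y (m + 1) := by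
  rw [walks, mem_filter] at hz ⊢
  refine ⟨mem_univ _, ?_⟩
  rw [ofFn_snoc, ← List.cons_append, ← List.cons_append, List.isChain_append]
  refine ⟨hz.2, List.isChain_singleton _, ?_⟩
  intro a ha b hb
  rw [List.getLast?_concat] at ha
  simp only [Option.mem_def, Option.some.injEq, List.head?_cons] at ha hb
  rwa [← ha, ← hb]

lemma le_card_walks_succ {T : Finset (Fin k → Fin n)} {x y : Fin k → Fin n} {m : ℕ} {b : ℝ}
    {A : Finset (Fin k → Fin n)} (hA : ∀ s ∈ A, Step T s y ∧ b ≤ (walks T x s m).card) :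
    b * A.card ≤ (walks T x y (m + 1)).card := by
  refine mul_card_le_of_fibers (fun z => z (Fin.last m)) fun s hs => (hA s hs).2.trans ?_
  refine Nat.cast_le.2 (card_le_card_of_injOn (fun z => Fin.snoc z s) ?_ ?_)
  · intro z hz
    simp only [mem_coe, mem_filter, Fin.snoc_last, and_true]
    exact snoc_mem_walks hz (hA s hs).1
  · intro z _ z' _ h
    exact (Fin.snoc_inj.1 h).1

/-- The points reached from `x` by a positive proportion of the short walks. -/
noncomputable def reached (T : Finset (Fin k → Fin n)) (x : Fin k → Fin n) (M : ℕ) (β : ℝ) :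
    Finset (Fin k → Fin n) :=
  T.filter fun y => ∃ m ≤ M, β * ((n : ℝ) ^ k) ^ m ≤ (walks T x y m).card

lemma reached_succ {T : Finset (Fin k → Fin n)} {x y : Fin k → Fin n} {M : ℕ} {a β : ℝ}
    (hn : 0 < n) (hβ : 0 ≤ β)
    (h : a * n ^ k ≤ ((reached T x M β).filter fun s => Step T s y).card) :
    ∃ m ≤ M + 1, 1 ≤ m ∧ a / (M + 1) * β * ((n : ℝ) ^ k) ^ m ≤ (walks T x y m).card := by
  set A := (reached T x M β).filter fun s => Step T s y with hA
  set B : ℕ → Finset (Fin k → Fin n) := fun m =>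
    A.filter fun s => β * ((n : ℝ) ^ k) ^ m ≤ (walks T x s m).card with hB
  have h1 : A ⊆ (range (M + 1)).biUnion B := by
    intro s hs
    have hs' := hs
    rw [hA, mem_filter, reached, mem_filter] at hs
    obtain ⟨⟨_, m, hm, hw⟩, _⟩ := hs
    exact mem_biUnion.2 ⟨m, mem_range.2 (by omega), mem_filter.2 ⟨hs', hw⟩⟩
  have h2 : (A.card : ℝ) ≤ ∑ m ∈ range (M + 1), ((B m).card : ℝ) := by
    exact_mod_cast (card_le_card h1).trans card_biUnion_le
  have hM : (0 : ℝ) < M + 1 := by positivity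
  obtain ⟨m, hm, hmB⟩ : ∃ m ∈ range (M + 1), a * n ^ k / (M + 1) ≤ ((B m).card : ℝ) := by
    refine Finset.exists_le_of_sum_le ⟨0, by simp⟩ (le_trans (le_of_eq ?_) (h.trans h2))
    simp only [sum_const, card_range, nsmul_eq_mul]
    push_cast; field_simp
  refine ⟨m + 1, by rw [mem_range] at hm; omega, by omega, ?_⟩
  have h3 := le_card_walks_succ (T := T) (x := x) (y := y) (m := m) (A := B m)
    (b := β * ((n : ℝ) ^ k) ^ m) fun s hs => ⟨(mem_filter.1 (mem_filter.1 hs).1).2,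
      (mem_filter.1 hs).2⟩
  refine le_trans ?_ h3
  calc a / (M + 1) * β * ((n : ℝ) ^ k) ^ (m + 1)
      = β * ((n : ℝ) ^ k) ^ m * (a * n ^ k / (M + 1)) := by rw [pow_succ]; ring
    _ ≤ _ := by gcongr

lemma reached_mono {T : Finset (Fin k → Fin n)} {x : Fin k → Fin n} {M M' : ℕ} {β β' : ℝ}
    (hM : M ≤ M') (hβ : β' ≤ β) : reached T x M β ⊆ reached T x M' β' := by
  intro y hy
  rw [reached, mem_filter] at hy ⊢
  obtain ⟨hy, m, hm, hw⟩ := hy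
  exact ⟨hy, m, hm.trans hM, le_trans (by gcongr) hw⟩

lemma reached_grow {T : Finset (Fin k → Fin n)} {x : Fin k → Fin n} {M : ℕ} {c β : ℝ}
    (hn : 0 < n) (hβ : 0 < β) (hc : 0 < c) (hc1 : c ≤ 1)
    (h : c * ((n : ℝ) ^ k) ^ 2 ≤ (((reached T x M β ×ˢ (T \ reached T x M β)).filter
      fun p => Step T p.1 p.2).card : ℝ)) :
    ((reached T x M β).card : ℝ) + c / 2 * n ^ k ≤
      (reached T x (M + 1) (c / 2 / (M + 1) * β)).card := by
  set S := reached T x M β with hS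
  set N : ℝ := (n : ℝ) ^ k with hN
  have hN0 : 0 < N := by positivity
  set Y := (T \ S).filter fun y => c / 2 * N ≤ ((S.filter fun s => Step T s y).card : ℝ) with hY
  have h1 : (((S ×ˢ (T \ S)).filter fun p => Step T p.1 p.2).card : ℝ) =
      ∑ y ∈ T \ S, ((S.filter fun s => Step T s y).card : ℝ) := by
    rw [← Nat.cast_sum, card_filter, sum_product_right]
    simp only [card_filter]
  have h2 : ∀ y ∈ T \ S, ((S.filter fun s => Step T s y).card : ℝ) ≤
      c / 2 * N + if y ∈ Y then N else 0 := by
    intro y hy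
    split_ifs with h
    · have : ((S.filter fun s => Step T s y).card : ℝ) ≤ N := card_le_pow _
      have : 0 < c / 2 * N := by positivity
      linarith
    · rw [hY, mem_filter, not_and, not_le] at h
      linarith [h hy]
  have h3 : c * N ^ 2 ≤ c / 2 * N * (T \ S).card + N * Y.card := by
    refine h.trans (h1.le.trans ((Finset.sum_le_sum h2).trans (le_of_eq ?_)))
    rw [sum_add_distrib, ← sum_filter, sum_const, sum_const, nsmul_eq_mul, nsmul_eq_mul]
    have : (T \ S).filter (fun y => y ∈ Y) = Y := by
      rw [filter_mem_eq_inter, inter_eq_right]; exact filter_subset _ _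
    rw [this]; ring
  have h4 : ((T \ S).card : ℝ) ≤ N := card_le_pow _
  have h5 : c / 2 * N ≤ Y.card := by
    have : c / 2 * N * (T \ S).card ≤ c / 2 * N * N := by gcongr
    have : N * (c / 2 * N) ≤ N * Y.card := by linarith [h3]
    exact le_of_mul_le_mul_left this hN0
  have hdis : Disjoint S Y := by
    refine disjoint_of_subset_right (filter_subset _ _) disjoint_sdiff
  have hsub : S ∪ Y ⊆ reached T x (M + 1) (c / 2 / (M + 1) * β) := by
    refine union_subset (reached_mono (by omega) ?_) fun y hy => ?_
    · have : c / 2 / (M + 1) ≤ 1 := by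
        rw [div_le_one (by positivity)]
        have : (0 : ℝ) ≤ M := by positivity
        linarith
      nlinarith
    · rw [hY, mem_filter, mem_sdiff] at hy
      obtain ⟨m, hm, _, hw⟩ := reached_succ hn hβ.le hy.2
      rw [reached, mem_filter]
      exact ⟨hy.1.1, m, hm, hw⟩
  have := card_le_card hsub
  rw [card_union_of_disjoint hdis] at this
  have : (S.card : ℝ) + Y.card ≤ (reached T x (M + 1) (c / 2 / (M + 1) * β)).card := by
    exact_mod_cast this
  linarith

/-- A set with long lines that cannot be cut cheaply. -/
def IsCore (δ : ℝ) (T : Finset (Fin k → Fin n)) : Prop :=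
  (∀ x ∈ T, ∀ i, δ * n ≤ (line T i x).card) ∧ CutRobust T

lemma exists_reached (hk : 0 < k) {δ : ℝ} (hδ : 0 < δ) : ∃ (M : ℕ) (β : ℝ), 0 < β ∧
    ∀ (n : ℕ) (T : Finset (Fin k → Fin n)), 0 < n → IsCore δ T → ∀ x ∈ T,
      ((T \ reached T x M β).card : ℝ) ≤ δ ^ k / 2 * n ^ k := by
  obtain ⟨c₀, hc₀, hexp⟩ := expansion hk (α := δ ^ k / 2) (by positivity)
  set c := min c₀ 1 with hc
  have hc0 : 0 < c := lt_min hc₀ one_pos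
  have key : ∀ j : ℕ, ∃ (M : ℕ) (β : ℝ), 0 < β ∧
    ∀ (n : ℕ) (T : Finset (Fin k → Fin n)), 0 < n → IsCore δ T → ∀ x ∈ T,
      ((T \ reached T x M β).card : ℝ) ≤ δ ^ k / 2 * n ^ k ∨
      (δ ^ k / 2 + j * (c / 2)) * n ^ k ≤ ((reached T x M β).card : ℝ) := by
    intro j
    induction j with
    | zero =>
      refine ⟨0, 1, one_pos, fun n T hn hT x hx => Or.inr ?_⟩
      have h := pow_le_card_step (d := δ * n) (by positivity) ∅ (by simpa using hT.1) hx
      rw [mul_pow] at h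
      have h2 : ((univ.filter fun y => Step T x y ∧ ∀ i, y i ∉ (∅ : Finset (Fin n))).card : ℝ) ≤
          ((reached T x 0 1).card : ℝ) := by
        refine Nat.cast_le.2 (card_le_card fun y hy => ?_)
        rw [mem_filter] at hy
        rw [reached, mem_filter]
        refine ⟨hy.2.1.right, 0, le_rfl, ?_⟩
        rw [pow_zero, mul_one]
        refine Nat.one_le_cast.2 (card_pos.2 ⟨fun i => i.elim0, mem_filter.2 ⟨mem_univ _, ?_⟩⟩)
        simp [hy.2.1]
      have : 0 ≤ δ ^ k / 2 * (n : ℝ) ^ k := by positivity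
      push_cast
      linarith
    | succ j ih =>
      obtain ⟨M, β, hβ, ih⟩ := ih
      refine ⟨M + 1, c / 2 / (M + 1) * β, by positivity, fun n T hn hT x hx => ?_⟩
      have hmono : reached T x M β ⊆ reached T x (M + 1) (c / 2 / (M + 1) * β) := by
        refine reached_mono (by omega) ?_
        have : c / 2 / (M + 1) ≤ 1 := by
          rw [div_le_one (by positivity)]
          have : (0 : ℝ) ≤ M := by positivity
          have := min_le_right c₀ 1
          linarith
        nlinarith
      by_cases hbig : ((T \ reached T x M β).card : ℝ) ≤ δ ^ k / 2 * n ^ k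
      · left
        exact (Nat.cast_le.2 (card_le_card (sdiff_subset_sdiff le_rfl hmono))).trans hbig
      · right
        have hr := (ih n T hn hT x hx).resolve_left hbig
        have he := hexp n T hn hT.2 (reached T x M β) (filter_subset _ _)
          (le_trans (by gcongr; simp; positivity) hr) (not_le.1 hbig).le
        have := reached_grow hn hβ hc0 (min_le_right _ _)
          (le_trans (by gcongr; exact min_le_left _ _) he)
        push_cast
        refine le_trans ?_ this
        linarith
  obtain ⟨j, hj⟩ := exists_nat_gt (1 / (c / 2))
  obtain ⟨M, β, hβ, h⟩ := key j
  refine ⟨M, β, hβ, fun n T hn hT x hx => (h n T hn hT x hx).resolve_right fun h' => ?_⟩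
  have h1 : ((reached T x M β).card : ℝ) ≤ n ^ k := card_le_pow _
  have hN : (0 : ℝ) < (n : ℝ) ^ k := by positivity
  rw [div_lt_iff₀ (by positivity)] at hj
  have : 0 < δ ^ k := by positivity
  nlinarith

/-- Any two points of a core are joined by a positive proportion of the walks of some bounded
length. -/
lemma exists_walks (hk : 0 < k) {δ : ℝ} (hδ : 0 < δ) : ∃ (M : ℕ) (β : ℝ), 0 < β ∧
    ∀ (n : ℕ) (T : Finset (Fin k → Fin n)), 0 < n → IsCore δ T → ∀ x ∈ T, ∀ y ∈ T,
      ∃ m ≤ M, 1 ≤ m ∧ β * ((n : ℝ) ^ k) ^ m ≤ (walks T x y m).card := by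
  obtain ⟨M, β, hβ, h⟩ := exists_reached hk hδ
  refine ⟨M + 1, δ ^ k / 2 / (M + 1) * β, by positivity, fun n T hn hT x hx y hy => ?_⟩
  refine reached_succ hn hβ.le ?_
  have h1 := h n T hn hT x hx
  have h2 := pow_le_card_step_left (d := δ * n) (by positivity) hT.1 hy
  rw [mul_pow] at h2
  have h3 : ((univ.filter fun s => Step T s y).card : ℝ) ≤ ((T \ reached T x M β).card : ℝ) +
      (((reached T x M β).filter fun s => Step T s y).card : ℝ) := by
    rw [← Nat.cast_add]
    refine Nat.cast_le.2 ((card_le_card fun s hs => ?_).trans (card_union_le _ _))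
    rw [mem_filter] at hs
    by_cases hs' : s ∈ reached T x M β
    · exact mem_union_right _ (mem_filter.2 ⟨hs', hs.2⟩)
    · exact mem_union_left _ (mem_sdiff.2 ⟨hs.2.left, hs'⟩)
  linarith

lemma exists_injective_avoiding {ι : Type*} [Fintype ι] [DecidableEq ι] {F : Finset (ι → Fin n)}
    {U : Finset (Fin n)} {β : ℝ} (hn : 0 < n)
    (h : (Fintype.card ι : ℝ) * (U.card + Fintype.card ι) < β * n)
    (hF : β * (n : ℝ) ^ Fintype.card ι ≤ F.card) :
    ∃ f ∈ F, Function.Injective f ∧ ∀ i, f i ∉ U := by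
  set c := Fintype.card ι with hc
  have hn' : (0 : ℝ) < n := by exact_mod_cast hn
  by_contra hcon
  push Not at hcon
  set E : Finset (ι → Fin n) :=
    univ.image fun e : ι ↪ {v : Fin n // v ∉ U} => fun i => (e i : Fin n) with hE
  have hEc : E.card = (n - U.card).descFactorial c := by
    rw [hE, card_image_of_injective, card_univ, Fintype.card_embedding_eq]
    · congr 1
      rw [Fintype.card_subtype_compl]; simp
    · intro e e' hee
      ext i
      exact congrArg Fin.val (congrFun hee i)
  have hdis : Disjoint F E := by
    rw [Finset.disjoint_left]
    intro f hf hfE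
    rw [hE, mem_image] at hfE
    obtain ⟨e, _, rfl⟩ := hfE
    obtain ⟨i, hi⟩ := hcon _ hf fun i j hij => e.injective (Subtype.ext hij)
    exact (e i).2 hi
  have hsum : (F.card : ℝ) + E.card ≤ (n : ℝ) ^ c := by
    have := card_le_univ (F ∪ E)
    rw [card_union_of_disjoint hdis] at this
    simp only [Fintype.card_pi, Fintype.card_fin, prod_const, card_univ] at this
    exact_mod_cast this
  have hpos : 0 < (n : ℝ) ^ c := by positivity
  have hβ : β ≤ 1 := by
    have : (0 : ℝ) ≤ E.card := by positivity
    by_contra hβ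
    nlinarith
  rcases Nat.eq_zero_or_pos c with h0 | h0
  · rw [h0] at hEc hsum hF h
    simp only [Nat.descFactorial_zero] at hEc
    rw [hEc] at hsum
    simp only [pow_zero, mul_one, Nat.cast_one, Nat.cast_zero, zero_mul] at hsum hF h
    nlinarith
  · have h1 : (1 : ℝ) ≤ c := by exact_mod_cast h0
    have h2 : (U.card : ℝ) + c < n := by
      have : (U.card : ℝ) + c ≤ c * (U.card + c) := by
        have : (0 : ℝ) ≤ U.card + c := by positivity
        nlinarith
      nlinarith
    have h3 : ((n : ℝ) - U.card - c) ^ c ≤ E.card := by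
      rw [hEc]
      have h4 : U.card + c < n := by exact_mod_cast h2
      have := Nat.pow_sub_le_descFactorial (n - U.card) c
      refine le_trans ?_ (Nat.cast_le.2 this)
      push_cast [Nat.cast_sub (show c ≤ n - U.card + 1 by omega),
        Nat.cast_sub (show U.card ≤ n by omega)]
      gcongr
      · linarith
      · linarith
    have h5 := one_add_mul_le_pow (a := -(((U.card : ℝ) + c) / n)) (by
      have : ((U.card : ℝ) + c) / n ≤ 1 := by rw [div_le_one hn']; exact h2.le
      linarith) c
    have h6 : ((n : ℝ) - U.card - c) ^ c = n ^ c * (1 + -(((U.card : ℝ) + c) / n)) ^ c := by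
      rw [← mul_pow]; congr 1; field_simp; ring
    have h7 : (c : ℝ) * (((U.card : ℝ) + c) / n) < β := by
      rw [← mul_div_assoc, div_lt_iff₀ hn']; exact h
    rw [h6] at h3
    have h8 := mul_le_mul_of_nonneg_left h5 hpos.le
    nlinarith

lemma exists_disjoint_family {ι : Type*} [Fintype ι] [DecidableEq ι] {F : Finset (ι → Fin n)}
    {β : ℝ} (hn : 0 < n) (hF : β * (n : ℝ) ^ Fintype.card ι ≤ F.card) (q : ℕ)
    (h : (Fintype.card ι : ℝ) * (Fintype.card ι * q + Fintype.card ι) < β * n) :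
    ∃ L : List (ι → Fin n), L.length = q ∧ (∀ f ∈ L, f ∈ F ∧ Function.Injective f) ∧
      L.Pairwise fun f g => ∀ i j, f i ≠ g j := by
  induction q with
  | zero => exact ⟨[], rfl, by simp, List.Pairwise.nil⟩
  | succ q ih =>
    obtain ⟨L, hL, hLF, hLp⟩ := ih (lt_of_le_of_lt (by gcongr; simp) h)
    set U : Finset (Fin n) := L.toFinset.biUnion fun f => univ.image f with hU
    have hUc : U.card ≤ Fintype.card ι * q := by
      refine (card_biUnion_le_card_mul _ _ (Fintype.card ι) fun f _ => card_image_le).trans ?_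
      rw [mul_comm, ← hL]
      exact Nat.mul_le_mul_left _ (List.toFinset_card_le _)
    have hUc' : (U.card : ℝ) ≤ Fintype.card ι * (q + 1 : ℕ) := by
      refine le_trans (Nat.cast_le.2 hUc) ?_
      push_cast; gcongr; simp
    obtain ⟨f, hfF, hfi, hfU⟩ := exists_injective_avoiding (U := U) hn
      (lt_of_le_of_lt (by gcongr) h) hF
    refine ⟨f :: L, by simp [hL], ?_, List.pairwise_cons.2 ⟨fun g hg i j hij => ?_, hLp⟩⟩
    · intro g hg
      rcases List.mem_cons.1 hg with rfl | hg
      · exact ⟨hfF, hfi⟩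
      · exact hLF g hg
    · refine hfU i (mem_biUnion.2 ⟨g, List.mem_toFinset.2 hg, ?_⟩)
      rw [hij]; exact mem_image_of_mem _ (mem_univ _)

/-- Few colourings avoid making one of many disjoint sets monochromatic of a given colour. -/
lemma card_avoid_le {ι : Type*} [Fintype ι] [DecidableEq ι] {s : ℕ} (hs : 0 < s) (a : Fin s)
    (L : List (ι → Fin n)) (hL : L.Pairwise fun f g => ∀ i j, f i ≠ g j) :
    ((univ.filter fun φ : Fin n → Fin s => ∀ f ∈ L, ∃ i, φ (f i) ≠ a).card : ℝ) ≤
      s ^ n * (1 - ((s : ℝ) ^ Fintype.card ι)⁻¹) ^ L.length := by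
  have hs' : (1 : ℝ) ≤ s := by exact_mod_cast hs
  have hp : (1 : ℝ) ≤ (s : ℝ) ^ Fintype.card ι := one_le_pow₀ hs'
  induction L with
  | nil => simp
  | cons f L ih =>
    rw [List.pairwise_cons] at hL
    have ih := ih hL.2
    set B := univ.filter fun φ : Fin n → Fin s => ∀ f ∈ L, ∃ i, φ (f i) ≠ a with hB
    have hsplit : (univ.filter fun φ : Fin n → Fin s => ∀ g ∈ f :: L, ∃ i, φ (g i) ≠ a) =
        B.filter fun φ => ¬ ∀ i, φ (f i) = a := by
      ext φ
      simp only [mem_filter, mem_univ, true_and, List.mem_cons, forall_eq_or_imp, hB, not_forall]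
      tauto
    have hcount : B.card ≤ (B.filter fun φ => ∀ i, φ (f i) = a).card * s ^ Fintype.card ι := by
      have : ((B.filter fun φ => ∀ i, φ (f i) = a) ×ˢ
          (univ : Finset (ι → Fin s))).card =
          (B.filter fun φ => ∀ i, φ (f i) = a).card * s ^ Fintype.card ι := by
        rw [card_product]; simp
      rw [← this]
      refine card_le_card_of_injOn
        (fun φ => (fun v => if v ∈ Set.range f then a else φ v, φ ∘ f)) ?_ ?_
      · intro φ hφ
        simp only [hB, mem_coe, mem_filter, mem_univ, true_and] at hφ
        simp only [hB, mem_coe, mem_product, mem_filter, mem_univ, true_and, and_true]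
        refine ⟨fun g hg => ?_, fun i => if_pos ⟨i, rfl⟩⟩
        obtain ⟨i, hi⟩ := hφ g hg
        refine ⟨i, ?_⟩
        rwa [if_neg]
        rintro ⟨j, hj⟩
        exact hL.1 g hg j i hj
      · intro φ _ φ' _ h
        simp only [Prod.mk.injEq] at h
        ext v
        by_cases hv : v ∈ Set.range f
        · obtain ⟨i, rfl⟩ := hv
          exact congrArg Fin.val (congrFun h.2 i)
        · have := congrFun h.1 v
          simp only [if_neg hv] at this
          rw [this]
    have hadd := card_filter_add_card_filter_not (s := B) fun φ => ∀ i, φ (f i) = a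
    rw [hsplit, List.length_cons, pow_succ]
    have h1 : (B.card : ℝ) ≤ (B.filter fun φ => ∀ i, φ (f i) = a).card *
        (s : ℝ) ^ Fintype.card ι := by exact_mod_cast hcount
    have h2 : ((B.filter fun φ => ∀ i, φ (f i) = a).card : ℝ) +
        (B.filter fun φ => ¬ ∀ i, φ (f i) = a).card = B.card := by exact_mod_cast hadd
    have h3 : (B.card : ℝ) * ((s : ℝ) ^ Fintype.card ι)⁻¹ ≤
        (B.filter fun φ => ∀ i, φ (f i) = a).card := by
      rw [← div_eq_mul_inv, div_le_iff₀ (by positivity)]; exact h1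
    have h4 : 0 ≤ 1 - ((s : ℝ) ^ Fintype.card ι)⁻¹ := by
      have := inv_le_one_of_one_le₀ hp
      linarith
    have := mul_le_mul_of_nonneg_right ih h4
    linarith

lemma card_filter_fin_lt_le (s Q : ℕ) : (univ.filter fun u : Fin s => (u : ℕ) < Q).card ≤ Q := by
  have := card_le_card_of_injOn (s := univ.filter fun u : Fin s => (u : ℕ) < Q) (t := range Q)
    Fin.val (fun u hu => by simpa using hu) (Fin.val_injective.injOn)
  rwa [card_range] at this

lemma card_large_class_le {s Q : ℕ} (hs : 0 < s) (t : ℝ) :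
    t * ((univ.filter fun φ : Fin n → Fin s =>
      t ≤ ((univ.filter fun v => (φ v : ℕ) < Q).card : ℝ)).card : ℝ) ≤ n * Q * (s : ℝ) ^ n / s := by
  have h1 : t * ((univ.filter fun φ : Fin n → Fin s =>
      t ≤ ((univ.filter fun v => (φ v : ℕ) < Q).card : ℝ)).card : ℝ) ≤
      ∑ φ : Fin n → Fin s, ((univ.filter fun v => (φ v : ℕ) < Q).card : ℝ) := by
    rw [mul_comm, ← nsmul_eq_mul]
    refine (card_nsmul_le_sum _ _ t fun φ hφ => (mem_filter.1 hφ).2).trans ?_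
    exact sum_le_sum_of_subset_of_nonneg (filter_subset _ _) fun _ _ _ => by positivity
  refine h1.trans ?_
  have h2 : ∀ φ : Fin n → Fin s, ((univ.filter fun v => (φ v : ℕ) < Q).card : ℝ) =
      ∑ v, if (φ v : ℕ) < Q then 1 else 0 := fun φ => by
    rw [card_filter]; push_cast; rfl
  simp only [h2]
  rw [sum_comm]
  have h3 : ∀ v : Fin n, (∑ φ : Fin n → Fin s, if (φ v : ℕ) < Q then (1 : ℝ) else 0) ≤
      Q * (s : ℝ) ^ n / s := by
    intro v
    have h4 : ∀ u : Fin s, s * (univ.filter fun φ : Fin n → Fin s => φ v = u).card = s ^ n := by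
      intro u
      have : (univ.filter fun φ : Fin n → Fin s => φ v = u) =
          Fintype.piFinset fun w => if w = v then {u} else univ := by
        ext φ
        simp only [mem_filter, mem_univ, true_and, Fintype.mem_piFinset]
        constructor
        · intro h w
          split_ifs with hw
          · subst hw; simp [h]
          · simp
        · intro h; simpa using h v
      rw [this, Fintype.card_piFinset]
      have hn : 0 < n := v.pos
      rw [← Finset.mul_prod_erase univ _ (mem_univ v)]
      rw [Finset.prod_congr rfl (g := fun _ => s) fun w hw => by
        rw [if_neg (mem_erase.1 hw).1]; simp]
      simp only [if_true, card_singleton, one_mul, prod_const]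
      rw [card_erase_of_mem (mem_univ _), card_univ, Fintype.card_fin, ← pow_succ',
        Nat.sub_add_cancel hn]
    have h5 : (∑ φ : Fin n → Fin s, if (φ v : ℕ) < Q then (1 : ℝ) else 0) =
        ∑ u : Fin s, if (u : ℕ) < Q then (s : ℝ) ^ n / s else 0 := by
      rw [← Finset.sum_fiberwise univ (fun φ : Fin n → Fin s => φ v)]
      refine Finset.sum_congr rfl fun u _ => ?_
      have h6 : ((univ.filter fun φ : Fin n → Fin s => φ v = u).card : ℝ) = (s : ℝ) ^ n / s := by
        rw [eq_div_iff (by positivity), mul_comm]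
        exact_mod_cast h4 u
      rw [← h6, Finset.sum_congr rfl (g := fun _ => if (u : ℕ) < Q then (1 : ℝ) else 0)
        fun φ hφ => by rw [(mem_filter.1 hφ).2]]
      rw [sum_const, nsmul_eq_mul]
      split_ifs <;> simp
    rw [h5, ← sum_filter, sum_const, nsmul_eq_mul, mul_div_assoc]
    have h7 : (univ.filter fun u : Fin s => (u : ℕ) < Q).card ≤ Q := card_filter_fin_lt_le s Q
    gcongr
  refine (Finset.sum_le_sum fun v _ => h3 v).trans (le_of_eq ?_)
  simp only [sum_const, card_univ, Fintype.card_fin, nsmul_eq_mul]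
  ring

/-- The sequence of vertices of a sequence of points. -/
def verts (L : List (Fin k → Fin n)) : List (Fin n) := L.flatMap List.ofFn

lemma mem_verts {L : List (Fin k → Fin n)} {v : Fin n} : v ∈ verts L ↔ ∃ x ∈ L, ∃ i, x i = v := by
  simp [verts, List.mem_flatMap, List.mem_ofFn]

lemma nodup_verts_ofFn {m : ℕ} {z : Fin m → Fin k → Fin n}
    (hz : Function.Injective fun p : Fin m × Fin k => z p.1 p.2) :
    (verts (List.ofFn z)).Nodup := by
  rw [verts, List.nodup_flatMap]
  constructor
  · intro x hx
    obtain ⟨i, rfl⟩ := List.mem_ofFn.1 hx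
    rw [List.nodup_ofFn]
    intro a b hab
    have := @hz (i, a) (i, b) hab
    simpa using this
  · rw [List.pairwise_ofFn]
    intro i j hij
    simp only [Function.onFun, List.disjoint_left, List.mem_ofFn]
    rintro v ⟨a, rfl⟩ ⟨b, hb⟩
    have := @hz (j, b) (i, a) hb
    simp only [Prod.mk.injEq] at this
    exact hij.ne' this.1

/-- Any two points of `T` can be joined, using at most `M` intermediate points, by a walk with
distinct vertices, all inside `Z`. -/
def Joins (T : Finset (Fin k → Fin n)) (M : ℕ) (Z : Finset (Fin n)) : Prop :=
  ∀ x ∈ T, ∀ y ∈ T, ∃ L : List (Fin k → Fin n), L.length ≤ M ∧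
    List.IsChain (Step T) (x :: (L ++ [y])) ∧ (verts L).Nodup ∧ ∀ v ∈ verts L, v ∈ Z

lemma exists_not_joins {T : Finset (Fin k → Fin n)} {M s q : ℕ} {β : ℝ} (hn : 0 < n)
    (hs : 0 < s) (hM : ∀ x ∈ T, ∀ y ∈ T, ∃ m ≤ M, 1 ≤ m ∧
      β * ((n : ℝ) ^ k) ^ m ≤ (walks T x y m).card)
    (hq : ((M * k : ℕ) : ℝ) * ((M * k : ℕ) * q + (M * k : ℕ)) < β * n) (a : Fin s) :
    ∃ B : Finset (Fin n → Fin s),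
      (B.card : ℝ) ≤ ((n : ℝ) ^ k) ^ 2 * (s ^ n * (1 - ((s : ℝ) ^ (M * k))⁻¹) ^ q) ∧
      ∀ φ, φ ∉ B → Joins T M (univ.filter fun v => φ v = a) := by
  have hs' : (1 : ℝ) ≤ s := by exact_mod_cast hs
  have key : ∀ p : (Fin k → Fin n) × (Fin k → Fin n), ∃ B : Finset (Fin n → Fin s),
      (B.card : ℝ) ≤ s ^ n * (1 - ((s : ℝ) ^ (M * k))⁻¹) ^ q ∧
      (p.1 ∈ T → p.2 ∈ T → ∀ φ, φ ∉ B → ∃ L : List (Fin k → Fin n), L.length ≤ M ∧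
        List.IsChain (Step T) (p.1 :: (L ++ [p.2])) ∧ (verts L).Nodup ∧
        ∀ v ∈ verts L, φ v = a) := by
    rintro ⟨x, y⟩
    by_cases hxy : x ∈ T ∧ y ∈ T
    swap
    · refine ⟨∅, ?_, fun h1 h2 => absurd ⟨h1, h2⟩ hxy⟩
      have : ((s : ℝ) ^ (M * k))⁻¹ ≤ 1 := inv_le_one_of_one_le₀ (one_le_pow₀ hs')
      have : 0 ≤ 1 - ((s : ℝ) ^ (M * k))⁻¹ := by linarith
      simp only [card_empty, Nat.cast_zero]
      positivity
    obtain ⟨m, hm, hm1, hw⟩ := hM x hxy.1 y hxy.2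
    set F : Finset (Fin m × Fin k → Fin n) :=
      (walks T x y m).image fun z p => z p.1 p.2 with hF
    have hFc : F.card = (walks T x y m).card := by
      refine card_image_of_injective _ fun z z' h => ?_
      ext i j
      exact congrArg Fin.val (congrFun h (i, j))
    have hcard : Fintype.card (Fin m × Fin k) = m * k := by simp
    have hmk : m * k ≤ M * k := Nat.mul_le_mul_right _ hm
    have hmk' : ((m * k : ℕ) : ℝ) ≤ ((M * k : ℕ) : ℝ) := Nat.cast_le.2 hmk
    obtain ⟨L, hL, hLF, hLp⟩ := exists_disjoint_family (F := F) (β := β) hn (by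
      rw [hcard, hFc, mul_comm m k, pow_mul]; exact hw) q (by
      rw [hcard]; exact lt_of_le_of_lt (by gcongr) hq)
    refine ⟨_, (card_avoid_le hs a L hLp).trans ?_, fun _ _ φ hφ => ?_⟩
    · rw [hcard, hL]
      have h1 : (1 : ℝ) ≤ (s : ℝ) ^ (m * k) := one_le_pow₀ hs'
      have h2 : ((s : ℝ) ^ (m * k))⁻¹ ≤ 1 := inv_le_one_of_one_le₀ h1
      have h3 : (s : ℝ) ^ (m * k) ≤ (s : ℝ) ^ (M * k) := pow_le_pow_right₀ hs' hmk
      have h4 : ((s : ℝ) ^ (M * k))⁻¹ ≤ ((s : ℝ) ^ (m * k))⁻¹ := by gcongr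
      have h5 : 0 ≤ 1 - ((s : ℝ) ^ (m * k))⁻¹ := by linarith
      gcongr
    · simp only [mem_filter, mem_univ, true_and, not_forall, not_exists, not_not] at hφ
      obtain ⟨f, hf, hfa⟩ := hφ
      obtain ⟨hfF, hfi⟩ := hLF f hf
      rw [hF, mem_image] at hfF
      obtain ⟨z, hz, rfl⟩ := hfF
      refine ⟨List.ofFn z, by simpa using hm, (mem_filter.1 hz).2, nodup_verts_ofFn hfi, ?_⟩
      intro v hv
      rw [mem_verts] at hv
      obtain ⟨w, hw, i, rfl⟩ := hv
      obtain ⟨j, rfl⟩ := List.mem_ofFn.1 hw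
      exact hfa (j, i)
  choose B hBc hB using key
  refine ⟨univ.biUnion B, ?_, fun φ hφ x hx y hy => ?_⟩
  · have : ((univ.biUnion B).card : ℝ) ≤ ∑ p, ((B p).card : ℝ) := by
      exact_mod_cast card_biUnion_le
    refine this.trans ((Finset.sum_le_sum fun p _ => hBc p).trans (le_of_eq ?_))
    simp only [sum_const, card_univ, Fintype.card_prod, Fintype.card_pi, Fintype.card_fin,
      prod_const, nsmul_eq_mul]
    push_cast; ring
  · obtain ⟨L, h1, h2, h3, h4⟩ := hB (x, y) hx hy φ fun h => hφ (mem_biUnion.2 ⟨_, mem_univ _, h⟩)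
    exact ⟨L, h1, h2, h3, fun v hv => mem_filter.2 ⟨mem_univ _, h4 v hv⟩⟩

open Filter Topology in
lemma eventually_poly_mul_pow_lt {ρ : ℝ} (h0 : 0 < ρ) (h1 : ρ < 1) (K D : ℕ) (hD : 0 < D) (C : ℝ)
    (hC : 0 < C) : ∀ᶠ n : ℕ in atTop, C * (n : ℝ) ^ K * ρ ^ (n / D) < 1 := by
  have h2 : Tendsto (fun q : ℕ => C * (D : ℝ) ^ K / ρ * ((q + 1 : ℕ) ^ K * ρ ^ (q + 1)))
      atTop (𝓝 (C * (D : ℝ) ^ K / ρ * 0)) := by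
    refine Tendsto.const_mul _ ?_
    have := tendsto_pow_const_mul_const_pow_of_abs_lt_one K (r := ρ) (by rwa [abs_of_pos h0])
    exact (tendsto_add_atTop_iff_nat (f := fun q : ℕ => (q : ℝ) ^ K * ρ ^ q) 1).2 this
  rw [mul_zero] at h2
  have h3 := (h2.comp (Nat.tendsto_div_const_atTop hD.ne')).eventually (gt_mem_nhds one_pos)
  filter_upwards [h3] with n hn
  refine lt_of_le_of_lt ?_ hn
  simp only [Function.comp_apply]
  have h4 : (n : ℝ) ≤ D * (n / D + 1 : ℕ) := by
    exact_mod_cast (Nat.lt_mul_div_succ n hD).le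
  calc C * (n : ℝ) ^ K * ρ ^ (n / D) ≤ C * (D * (n / D + 1 : ℕ)) ^ K * ρ ^ (n / D) := by gcongr
    _ = _ := by rw [mul_pow, pow_succ ρ]; field_simp

/-- Disjoint small reservoirs through which all pairs of points of a core can be joined. -/
lemma exists_reservoirs (hk : 0 < k) {δ : ℝ} (hδ : 0 < δ) : ∃ M : ℕ, ∀ (Q : ℕ) (ζ : ℝ), 0 < ζ →
    ∃ n₀ : ℕ, ∀ n ≥ n₀, ∀ T : Finset (Fin k → Fin n), IsCore δ T →
      ∃ Z : ℕ → Finset (Fin n), (∀ a b, a ≠ b → Disjoint (Z a) (Z b)) ∧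
        (((range Q).biUnion Z).card : ℝ) ≤ ζ * n ∧ ∀ a < Q, Joins T M (Z a) := by
  obtain ⟨M₀, β, hβ, hwalks⟩ := exists_walks hk hδ
  set M := M₀ + 1 with hM
  refine ⟨M, fun Q ζ hζ => ?_⟩
  obtain ⟨s, hs1⟩ := exists_nat_gt (2 * Q / ζ + Q + 2)
  have hsQ : Q < s := by
    have : (0 : ℝ) ≤ 2 * Q / ζ := by positivity
    have : (Q : ℝ) < s := by linarith
    exact_mod_cast this
  have hs2 : 2 * (Q : ℝ) < ζ * s := by
    have : 2 * (Q : ℝ) / ζ < s := by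
      have : (0 : ℝ) ≤ Q := by positivity
      linarith
    rwa [div_lt_iff₀' hζ] at this
  have hs3 : (2 : ℝ) < s := by
    have : (0 : ℝ) ≤ 2 * Q / ζ := by positivity
    have : (0 : ℝ) ≤ Q := by positivity
    linarith
  have hs0 : 0 < s := by omega
  set H := M * k with hH
  have hH0 : 0 < H := by positivity
  set ρ : ℝ := 1 - ((s : ℝ) ^ H)⁻¹ with hρ
  have hsH : (1 : ℝ) < (s : ℝ) ^ H := one_lt_pow₀ (by linarith) hH0.ne'
  have hρ0 : 0 < ρ := by
    have := inv_lt_one_of_one_lt₀ hsH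
    linarith
  have hρ1 : ρ < 1 := by
    have : 0 < ((s : ℝ) ^ H)⁻¹ := by positivity
    linarith
  obtain ⟨D, hD⟩ := exists_nat_gt (2 * (H : ℝ) ^ 2 / β)
  have hD0 : 0 < D := by
    have : (0 : ℝ) < D := lt_trans (by positivity) hD
    exact_mod_cast this
  have hev := eventually_poly_mul_pow_lt hρ0 hρ1 (2 * k) D hD0 (2 * (Q + 1)) (by positivity)
  rw [Filter.eventually_atTop] at hev
  obtain ⟨n₁, hn₁⟩ := hev
  obtain ⟨n₂, hn₂⟩ := exists_nat_gt (2 * (H : ℝ) ^ 2 / β)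
  refine ⟨max (max n₁ n₂) 1, fun n hn T hT => ?_⟩
  have hnn₁ : n₁ ≤ n := by omega
  have hnn₂ : n₂ ≤ n := by omega
  have hn0 : 0 < n := by omega
  have hn' : (0 : ℝ) < n := by exact_mod_cast hn0
  set q := n / D with hq
  have hqb : (H : ℝ) * (H * q + H) < β * n := by
    have h1 : 2 * (H : ℝ) ^ 2 < β * D := by rwa [div_lt_iff₀' hβ] at hD
    have h2 : 2 * (H : ℝ) ^ 2 < β * n := by
      rw [div_lt_iff₀' hβ] at hn₂
      have : (n₂ : ℝ) ≤ n := by exact_mod_cast hnn₂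
      nlinarith
    have h3 : (q : ℝ) * D ≤ n := by exact_mod_cast Nat.div_mul_le_self n D
    have h4 : 2 * (H : ℝ) ^ 2 * q ≤ β * n := by
      have : 2 * (H : ℝ) ^ 2 * q ≤ β * D * q := by gcongr
      nlinarith
    nlinarith
  have hbad := fun a : Fin s => exists_not_joins (T := T) (M := M) hn0 hs0 (fun x hx y hy => by
    obtain ⟨m, hm, h⟩ := hwalks n T hn0 hT x hx y hy
    exact ⟨m, by omega, h⟩) hqb a
  choose B hBc hB using hbad
  set C := univ.filter fun φ : Fin n → Fin s =>
    ζ * n ≤ ((univ.filter fun v => (φ v : ℕ) < Q).card : ℝ) with hC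
  have hCc : 2 * (C.card : ℝ) ≤ (s : ℝ) ^ n := by
    have h1 := card_large_class_le (n := n) (s := s) (Q := Q) hs0 (ζ * n)
    rw [← hC] at h1
    rw [le_div_iff₀ (by positivity)] at h1
    have h2 : (0 : ℝ) ≤ C.card := by positivity
    have h3 : n * (2 * Q * (2 * (C.card : ℝ))) ≤ n * (2 * Q * (s : ℝ) ^ n) := by
      have : 2 * (Q : ℝ) * (n * C.card) ≤ ζ * s * (n * C.card) := by gcongr
      nlinarith
    rcases Nat.eq_zero_or_pos Q with hQ | hQ
    · have : (C.card : ℝ) ≤ 0 := by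
        have : 0 < ζ * n * s := by positivity
        rw [hQ] at h1
        simp only [Nat.cast_zero, mul_zero, zero_mul] at h1
        nlinarith
      have : (0 : ℝ) ≤ (s : ℝ) ^ n := by positivity
      linarith
    · have hQ' : (0 : ℝ) < Q := by exact_mod_cast hQ
      have := le_of_mul_le_mul_left h3 hn'
      exact le_of_mul_le_mul_left this (by positivity)
  set BB := (univ.filter fun a : Fin s => (a : ℕ) < Q).biUnion B with hBB
  have hBBc : 2 * (BB.card : ℝ) < (s : ℝ) ^ n := by
    have h1 : (BB.card : ℝ) ≤ ∑ a ∈ univ.filter fun a : Fin s => (a : ℕ) < Q, ((B a).card : ℝ) := by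
      exact_mod_cast card_biUnion_le
    have h2 : (univ.filter fun u : Fin s => (u : ℕ) < Q).card ≤ Q := card_filter_fin_lt_le s Q
    have h3 : (BB.card : ℝ) ≤ (Q + 1) * (((n : ℝ) ^ k) ^ 2 * (s ^ n * ρ ^ q)) := by
      refine h1.trans ((Finset.sum_le_sum fun a _ => hBc a).trans ?_)
      rw [sum_const, nsmul_eq_mul]
      have : ((univ.filter fun u : Fin s => (u : ℕ) < Q).card : ℝ) ≤ Q + 1 := by
        exact_mod_cast h2.trans (Nat.le_succ _)
      gcongr
    have h4 := hn₁ n hnn₁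
    have h5 : (0 : ℝ) < (s : ℝ) ^ n := by positivity
    have h6 := mul_lt_mul_of_pos_left h4 h5
    rw [mul_one] at h6
    refine lt_of_le_of_lt ?_ h6
    refine (mul_le_mul_of_nonneg_left h3 (by norm_num)).trans (le_of_eq ?_)
    rw [mul_comm 2 k, pow_mul]; ring
  obtain ⟨φ, hφ⟩ : ∃ φ : Fin n → Fin s, φ ∉ C ∪ BB := by
    by_contra hcon
    push Not at hcon
    have h1 : (univ : Finset (Fin n → Fin s)).card ≤ (C ∪ BB).card :=
      card_le_card fun φ _ => hcon φ
    have h2 : (s : ℝ) ^ n ≤ C.card + BB.card := by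
      have := h1.trans (card_union_le _ _)
      simp only [card_univ, Fintype.card_pi, Fintype.card_fin, prod_const] at this
      exact_mod_cast this
    linarith
  rw [mem_union, not_or] at hφ
  refine ⟨fun a => univ.filter fun v => (φ v : ℕ) = a, fun a b hab => ?_, ?_, fun a ha => ?_⟩
  · rw [Finset.disjoint_left]
    intro v hv hv'
    exact hab ((mem_filter.1 hv).2.symm.trans (mem_filter.1 hv').2)
  · have h1 := hφ.1
    simp only [hC, mem_filter, mem_univ, true_and, not_le] at h1
    refine le_trans (Nat.cast_le.2 (card_le_card fun v hv => ?_)) h1.le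
    simp only [mem_biUnion, mem_range, mem_filter, mem_univ, true_and] at hv ⊢
    obtain ⟨a, ha, h⟩ := hv
    omega
  · have h1 := hB ⟨a, ha.trans hsQ⟩ φ fun h =>
      hφ.2 (mem_biUnion.2 ⟨_, by simp [ha], h⟩)
    simpa [Fin.ext_iff] using h1

lemma exists_common_subset {X : Type*} [Fintype X] [DecidableEq X] {n t : ℕ} {δ : ℝ} (hδ : 0 < δ)
    (hn : 0 < n) (htn : t ≤ n) (hnt : 4 * t ≤ δ * n) (G : X → Finset (Fin n))
    (h : δ * n * Fintype.card X ≤ ∑ x, ((G x).card : ℝ)) :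
    ∃ A : Finset (Fin n), A.card = t ∧
      δ / 2 * (δ / 4) ^ t / t.factorial * Fintype.card X ≤
        ((univ.filter fun x => A ⊆ G x).card : ℝ) := by
  have hn' : (0 : ℝ) < n := by exact_mod_cast hn
  set L := univ.filter fun x => δ / 2 * n ≤ ((G x).card : ℝ) with hL
  have hLc : δ / 2 * Fintype.card X ≤ L.card := by
    have h1 : ∀ x ∈ univ, ((G x).card : ℝ) ≤ δ / 2 * n + if x ∈ L then (n : ℝ) else 0 := by
      intro x _
      split_ifs with hx
      · have : ((G x).card : ℝ) ≤ n := by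
          have := card_le_univ (G x)
          rw [Fintype.card_fin] at this
          exact_mod_cast this
        have : 0 < δ / 2 * n := by positivity
        linarith
      · rw [hL, mem_filter, not_and, not_le] at hx
        linarith [hx (mem_univ _)]
    have h2 := h.trans (Finset.sum_le_sum h1)
    rw [sum_add_distrib, ← sum_filter, sum_const, sum_const, nsmul_eq_mul, nsmul_eq_mul,
      filter_mem_eq_inter, univ_inter, card_univ] at h2
    have h3 : n * (δ / 2 * Fintype.card X) ≤ n * (L.card : ℝ) := by linarith
    exact le_of_mul_le_mul_left h3 hn'
  have hch : ∀ x ∈ L, (δ / 4) ^ t * n ^ t / t.factorial ≤ (((G x).powersetCard t).card : ℝ) := by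
    intro x hx
    have hx' : δ / 2 * n ≤ ((G x).card : ℝ) := (mem_filter.1 hx).2
    rw [card_powersetCard]
    refine le_trans ?_ (Nat.pow_le_choose t (G x).card)
    rw [← mul_pow]
    have htx : t ≤ (G x).card + 1 := by
      have : (t : ℝ) ≤ (G x).card + 1 := by
        have : (0 : ℝ) ≤ t := by positivity
        nlinarith
      exact_mod_cast this
    push_cast [Nat.cast_sub htx]
    gcongr
    nlinarith
  have hsum : (δ / 2 * Fintype.card X) * ((δ / 4) ^ t * n ^ t / t.factorial) ≤
      ∑ A ∈ (univ : Finset (Fin n)).powersetCard t, ((univ.filter fun x => A ⊆ G x).card : ℝ) := by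
    have h1 : ∑ A ∈ (univ : Finset (Fin n)).powersetCard t,
        ((univ.filter fun x => A ⊆ G x).card : ℝ) = ∑ x, (((G x).powersetCard t).card : ℝ) := by
      simp only [← Nat.cast_sum]
      congr 1
      simp only [card_filter]
      rw [sum_comm]
      refine Finset.sum_congr rfl fun x _ => ?_
      rw [← card_filter]
      congr 1
      ext A
      simp only [mem_filter, mem_powersetCard, subset_univ, true_and]
      tauto
    rw [h1]
    calc (δ / 2 * Fintype.card X) * ((δ / 4) ^ t * n ^ t / t.factorial)
        ≤ L.card * ((δ / 4) ^ t * n ^ t / t.factorial) := by gcongr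
      _ = ∑ x ∈ L, ((δ / 4) ^ t * n ^ t / t.factorial) := by simp
      _ ≤ ∑ x ∈ L, (((G x).powersetCard t).card : ℝ) := Finset.sum_le_sum hch
      _ ≤ _ := sum_le_sum_of_subset_of_nonneg (subset_univ _) fun _ _ _ => by positivity
  obtain ⟨A, hA, hAc⟩ : ∃ A ∈ (univ : Finset (Fin n)).powersetCard t,
      δ / 2 * (δ / 4) ^ t / t.factorial * Fintype.card X ≤
        ((univ.filter fun x => A ⊆ G x).card : ℝ) := by
    refine Finset.exists_le_of_sum_le ?_ (le_trans ?_ hsum)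
    · rw [powersetCard_nonempty]; simpa using htn
    · rw [sum_const, nsmul_eq_mul, card_powersetCard, card_univ, Fintype.card_fin]
      have : ((n.choose t : ℕ) : ℝ) ≤ n ^ t := by exact_mod_cast Nat.choose_le_pow n t
      calc (n.choose t : ℝ) * (δ / 2 * (δ / 4) ^ t / t.factorial * Fintype.card X)
          ≤ n ^ t * (δ / 2 * (δ / 4) ^ t / t.factorial * Fintype.card X) := by gcongr
        _ = _ := by ring
  exact ⟨A, (mem_powersetCard.1 hA).2, hAc⟩

/-- A dense subset of `(Fin n)^k` contains a large combinatorial box. -/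
lemma exists_box (k t : ℕ) {δ : ℝ} (hδ : 0 < δ) : ∃ n₀ : ℕ, ∀ n ≥ n₀,
    ∀ T : Finset (Fin k → Fin n), δ * n ^ k ≤ T.card →
      ∃ A : Fin k → Finset (Fin n), (∀ i, (A i).card = t) ∧ Fintype.piFinset A ⊆ T := by
  induction k generalizing δ with
  | zero =>
    refine ⟨0, fun n _ T hT => ⟨fun i => i.elim0, fun i => i.elim0, fun x _ => ?_⟩⟩
    have : (0 : ℝ) < T.card := lt_of_lt_of_le (by simpa using hδ) hT
    obtain ⟨y, hy⟩ := card_pos.1 (by exact_mod_cast this)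
    rwa [Subsingleton.elim x y]
  | succ k ih =>
    obtain ⟨n₁, hn₁⟩ := ih (δ := δ / 2 * (δ / 4) ^ t / t.factorial) (by positivity)
    obtain ⟨n₂, hn₂⟩ := exists_nat_gt (4 * (t : ℝ) / δ)
    refine ⟨max (max n₁ n₂) (t + 1), fun n hn T hT => ?_⟩
    have hn0 : 0 < n := by omega
    have hnt : 4 * (t : ℝ) ≤ δ * n := by
      rw [div_lt_iff₀' hδ] at hn₂
      have : (n₂ : ℝ) ≤ n := by exact_mod_cast (show n₂ ≤ n by omega)
      nlinarith
    obtain ⟨A₀, hA₀, hc⟩ := exists_common_subset hδ hn0 (by omega) hnt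
      (fun x : Fin k → Fin n => univ.filter fun v => (Fin.cons v x : Fin (k + 1) → Fin n) ∈ T) (by
        refine le_trans (le_of_eq ?_) (hT.trans (le_of_eq ?_))
        · simp only [Fintype.card_pi, Fintype.card_fin, prod_const, card_univ]
          push_cast; ring
        · rw [← Nat.cast_sum, ← card_sigma]
          congr 1
          refine card_bij' (fun x _ => ⟨Fin.tail x, x 0⟩) (fun p _ => Fin.cons p.2 p.1) ?_ ?_ ?_ ?_
          · intro x hx; simpa using hx
          · rintro ⟨x, v⟩ h; simpa using h
          · intro x _; simp
          · rintro ⟨x, v⟩ _; simp)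
    simp only [Fintype.card_pi, Fintype.card_fin, prod_const, card_univ] at hc
    push_cast at hc
    obtain ⟨A, hA, hAT⟩ := hn₁ n (by omega) _ hc
    refine ⟨Fin.cons A₀ A, fun i => ?_, fun x hx => ?_⟩
    · refine Fin.cases ?_ (fun i => ?_) i
      · simpa using hA₀
      · simpa using hA i
    · rw [Fintype.mem_piFinset] at hx
      have h1 : Fin.tail x ∈ Fintype.piFinset A := by
        rw [Fintype.mem_piFinset]
        exact fun i => by simpa [Fin.tail] using hx i.succ
      have h2 := (mem_filter.1 (hAT h1)).2 (by simpa using hx 0 : x 0 ∈ A₀)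
      simpa using h2

/-- A class of the partition given by `P`. -/
def cls (P : Fin n → Fin m) (j : Fin m) : Finset (Fin n) := univ.filter fun v => P v = j

/-- The box of points whose coordinates lie in the classes prescribed by `τ`. -/
def box (P : Fin n → Fin m) (τ : Fin k → Fin m) : Finset (Fin k → Fin n) :=
  univ.filter fun x => P ∘ x = τ

/-- The box of `τ` contains a large subbox in which `T` is too sparse. -/
def Bad (T : Finset (Fin k → Fin n)) (P : Fin n → Fin m) (τ : Fin k → Fin m) : Prop :=
  ∃ A : Fin k → Finset (Fin n), (∀ i, A i ⊆ cls P (τ i)) ∧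
    (∀ i, (cls P (τ i)).card ≤ 4 * (A i).card) ∧
    2 * 4 ^ k * (T ∩ Fintype.piFinset A).card < (T ∩ box P τ).card

lemma box_eq (P : Fin n → Fin m) (τ : Fin k → Fin m) :
    box P τ = Fintype.piFinset fun i => cls P (τ i) := by
  ext x
  simp [box, cls, funext_iff]

lemma mem_box {P : Fin n → Fin m} {τ : Fin k → Fin m} {x : Fin k → Fin n} :
    x ∈ box P τ ↔ P ∘ x = τ := by simp [box]

lemma sum_sq_sub_const (B T : Finset (Fin k → Fin n)) (t : ℝ) :
    ∑ x ∈ B, ((if x ∈ T then (1 : ℝ) else 0) - t) ^ 2 =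
      (T ∩ B).card * (1 - 2 * t) + B.card * t ^ 2 := by
  have h : ∀ x ∈ B, ((if x ∈ T then (1 : ℝ) else 0) - t) ^ 2 =
      (if x ∈ T then (1 - 2 * t) else 0) + t ^ 2 := by
    intro x _
    split_ifs <;> ring
  rw [Finset.sum_congr rfl h, sum_add_distrib, ← sum_filter, sum_const, sum_const,
    filter_mem_eq_inter, inter_comm, nsmul_eq_mul, nsmul_eq_mul]

/-- The density of `T` in the box of `τ`. -/
noncomputable def density (T : Finset (Fin k → Fin n)) (P : Fin n → Fin m) (τ : Fin k → Fin m) :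
    ℝ := (T ∩ box P τ).card / (box P τ).card

lemma density_mul (T : Finset (Fin k → Fin n)) (P : Fin n → Fin m) (τ : Fin k → Fin m) :
    density T P τ * (box P τ).card = (T ∩ box P τ).card := by
  unfold density
  rcases eq_or_ne ((box P τ).card : ℝ) 0 with h | h
  · have : ((T ∩ box P τ).card : ℝ) ≤ (box P τ).card :=
      Nat.cast_le.2 (card_le_card inter_subset_right)
    rw [h] at this ⊢
    have h0 : (0 : ℝ) ≤ (T ∩ box P τ).card := by positivity
    rw [mul_zero]; linarith
  · rw [div_mul_cancel₀ _ h]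

lemma sum_sq_density_le (T : Finset (Fin k → Fin n)) (P : Fin n → Fin m) (τ : Fin k → Fin m)
    (t : ℝ) : (T ∩ box P τ).card * (1 - 2 * density T P τ) +
      (box P τ).card * density T P τ ^ 2 ≤
      (T ∩ box P τ).card * (1 - 2 * t) + (box P τ).card * t ^ 2 := by
  rw [← density_mul]
  have : (0 : ℝ) ≤ (box P τ).card := by positivity
  nlinarith [mul_nonneg this (sq_nonneg (density T P τ - t))]

lemma sum_sq_split_le {T : Finset (Fin k → Fin n)} {P : Fin n → Fin m} {τ : Fin k → Fin m}
    {A : Fin k → Finset (Fin n)} (hA : ∀ i, A i ⊆ cls P (τ i))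
    (hA4 : ∀ i, (cls P (τ i)).card ≤ 4 * (A i).card)
    (hAT : 2 * 4 ^ k * (T ∩ Fintype.piFinset A).card < (T ∩ box P τ).card) :
    ∑ x ∈ box P τ, ((if x ∈ T then (1 : ℝ) else 0) -
      (if x ∈ Fintype.piFinset A then density T P τ / 2 else density T P τ)) ^ 2 +
      1 / (4 * 4 ^ k) * ((box P τ).card * density T P τ ^ 2) ≤
    (T ∩ box P τ).card * (1 - 2 * density T P τ) + (box P τ).card * density T P τ ^ 2 := by
  set d := density T P τ with hd
  set B := box P τ with hB
  set R := Fintype.piFinset A with hR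
  have hRB : R ⊆ B := by
    rw [hB, box_eq]; exact Fintype.piFinset_subset _ _ hA
  have hc : (B.card : ℝ) ≤ 4 ^ k * R.card := by
    rw [hB, box_eq, hR, Fintype.card_piFinset, Fintype.card_piFinset]
    have : ∏ i, (cls P (τ i)).card ≤ ∏ i : Fin k, 4 * (A i).card :=
      Finset.prod_le_prod' fun i _ => hA4 i
    rw [Finset.prod_mul_distrib] at this
    simp only [prod_const, card_univ, Fintype.card_fin] at this
    exact_mod_cast this
  have hy : d * B.card = (T ∩ B).card := density_mul T P τ
  have hAT' : 2 * 4 ^ k * ((T ∩ R).card : ℝ) < (T ∩ B).card := by exact_mod_cast hAT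
  have hp : (0 : ℝ) < 4 ^ k := by positivity
  have hd0 : 0 ≤ d := by rw [hd, density]; positivity
  have hTR : (T ∩ R).card ≤ d * (R.card : ℝ) / 2 := by
    have h1 : 2 * 4 ^ k * ((T ∩ R).card : ℝ) ≤ d * (4 ^ k * R.card) :=
      hAT'.le.trans (hy.symm.le.trans (by gcongr))
    have h2 : 4 ^ k * ((T ∩ R).card : ℝ) ≤ 4 ^ k * (d * (R.card : ℝ) / 2) := by linarith
    exact le_of_mul_le_mul_left h2 hp
  have hsum : ∑ x ∈ B, ((if x ∈ T then (1 : ℝ) else 0) -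
      (if x ∈ R then d / 2 else d)) ^ 2 =
      (∑ x ∈ B, ((if x ∈ T then (1 : ℝ) else 0) - d) ^ 2 -
        ∑ x ∈ R, ((if x ∈ T then (1 : ℝ) else 0) - d) ^ 2) +
        ∑ x ∈ R, ((if x ∈ T then (1 : ℝ) else 0) - d / 2) ^ 2 := by
    rw [← sum_sdiff hRB, ← sum_sdiff hRB (f := fun x => ((if x ∈ T then (1 : ℝ) else 0) - d) ^ 2)]
    have e1 : ∑ x ∈ B \ R, ((if x ∈ T then (1 : ℝ) else 0) - (if x ∈ R then d / 2 else d)) ^ 2 =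
        ∑ x ∈ B \ R, ((if x ∈ T then (1 : ℝ) else 0) - d) ^ 2 :=
      Finset.sum_congr rfl fun x hx => by rw [if_neg (mem_sdiff.1 hx).2]
    have e2 : ∑ x ∈ R, ((if x ∈ T then (1 : ℝ) else 0) - (if x ∈ R then d / 2 else d)) ^ 2 =
        ∑ x ∈ R, ((if x ∈ T then (1 : ℝ) else 0) - d / 2) ^ 2 :=
      Finset.sum_congr rfl fun x hx => by rw [if_pos hx]
    rw [e1, e2]; ring
  rw [hsum, sum_sq_sub_const, sum_sq_sub_const, sum_sq_sub_const]
  have h3 : 1 / (4 * 4 ^ k) * ((B.card : ℝ) * d ^ 2) ≤ R.card * d ^ 2 / 4 := by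
    have : (B.card : ℝ) * d ^ 2 ≤ 4 ^ k * R.card * d ^ 2 := by gcongr
    rw [div_mul_eq_mul_div, div_le_div_iff₀ (by positivity) (by positivity)]
    linarith
  nlinarith [mul_le_mul_of_nonneg_right hTR hd0]

open Classical in
lemma exists_refinement {T : Finset (Fin k → Fin n)} {M : ℕ} (hm : m ≤ M) (P : Fin n → Fin m)
    (g : (Fin k → Fin n) → ℝ) (hg : ∀ x y, P ∘ x = P ∘ y → g x = g y) {ε : ℝ} (hε : 0 < ε)
    (hbad : ε * n ^ k < ∑ τ with Bad T P τ, ((T ∩ box P τ).card : ℝ)) :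
    ∃ m' ≤ M * 2 ^ (M ^ k * k), ∃ (P' : Fin n → Fin m') (g' : (Fin k → Fin n) → ℝ),
      (∀ x y, P' ∘ x = P' ∘ y → g' x = g' y) ∧
      ∑ x, ((if x ∈ T then (1 : ℝ) else 0) - g' x) ^ 2 ≤
        ∑ x, ((if x ∈ T then (1 : ℝ) else 0) - g x) ^ 2 - 1 / (4 * 4 ^ k) * ε ^ 2 * n ^ k := by
  have hA : ∀ τ, ∃ A : Fin k → Finset (Fin n), Bad T P τ → (∀ i, A i ⊆ cls P (τ i)) ∧
      (∀ i, (cls P (τ i)).card ≤ 4 * (A i).card) ∧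
      2 * 4 ^ k * (T ∩ Fintype.piFinset A).card < (T ∩ box P τ).card := by
    intro τ
    by_cases h : Bad T P τ
    · obtain ⟨A, h⟩ := h; exact ⟨A, fun _ => h⟩
    · exact ⟨fun _ => ∅, fun h' => absurd h' h⟩
  choose A hA using hA
  set d := density T P with hd
  set lab : Fin n → Fin m × (((Fin k → Fin m) × Fin k) → Bool) :=
    fun v => (P v, fun p => decide (v ∈ A p.1 p.2)) with hlab
  set e := Fintype.equivFin (Fin m × (((Fin k → Fin m) × Fin k) → Bool)) with he
  refine ⟨Fintype.card (Fin m × (((Fin k → Fin m) × Fin k) → Bool)), ?_, fun v => e (lab v),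
    fun x => if Bad T P (P ∘ x) ∧ x ∈ Fintype.piFinset (A (P ∘ x)) then d (P ∘ x) / 2
      else d (P ∘ x), ?_, ?_⟩
  · simp only [Fintype.card_prod, Fintype.card_pi, Fintype.card_fin, prod_const, card_univ,
      Fintype.card_bool]
    gcongr
    norm_num
  · intro x y hxy
    have h1 : ∀ i, lab (x i) = lab (y i) := fun i => e.injective (congrFun hxy i)
    simp only [hlab, Prod.mk.injEq] at h1
    have h2 : P ∘ x = P ∘ y := funext fun i => (h1 i).1
    have h3 : x ∈ Fintype.piFinset (A (P ∘ y)) ↔ y ∈ Fintype.piFinset (A (P ∘ y)) := by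
      simp only [Fintype.mem_piFinset]
      refine forall_congr' fun i => ?_
      have := congrFun (h1 i).2 (P ∘ y, i)
      simpa using this
    simp only [h2, h3]
  · have hfib : ∀ F : (Fin k → Fin n) → ℝ, ∑ x, F x = ∑ τ, ∑ x ∈ box P τ, F x := fun F =>
      (Finset.sum_fiberwise univ (fun x => P ∘ x) F).symm
    rw [hfib, hfib fun x => ((if x ∈ T then (1 : ℝ) else 0) - g x) ^ 2]
    have hloc : ∀ τ, ∑ x ∈ box P τ, ((if x ∈ T then (1 : ℝ) else 0) -
        (if Bad T P (P ∘ x) ∧ x ∈ Fintype.piFinset (A (P ∘ x)) then d (P ∘ x) / 2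
          else d (P ∘ x))) ^ 2 ≤
        ∑ x ∈ box P τ, ((if x ∈ T then (1 : ℝ) else 0) - g x) ^ 2 -
        1 / (4 * 4 ^ k) * (if Bad T P τ then ((box P τ).card : ℝ) * d τ ^ 2 else 0) := by
      intro τ
      have hold : (T ∩ box P τ).card * (1 - 2 * d τ) + (box P τ).card * d τ ^ 2 ≤
          ∑ x ∈ box P τ, ((if x ∈ T then (1 : ℝ) else 0) - g x) ^ 2 := by
        rcases (box P τ).eq_empty_or_nonempty with h | ⟨x₀, hx₀⟩
        · rw [h]; simp
        · refine (sum_sq_density_le T P τ (g x₀)).trans (le_of_eq ?_)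
          rw [← sum_sq_sub_const]
          refine Finset.sum_congr rfl fun x hx => ?_
          rw [hg x x₀ ((mem_box.1 hx).trans (mem_box.1 hx₀).symm)]
      by_cases hb : Bad T P τ
      · obtain ⟨h1, h2, h3⟩ := hA τ hb
        have := sum_sq_split_le h1 h2 h3
        rw [if_pos hb, le_sub_iff_add_le]
        refine le_trans (le_of_eq ?_) (this.trans hold)
        congr 1
        refine Finset.sum_congr rfl fun x hx => ?_
        rw [mem_box.1 hx]; simp only [hb, true_and]; rfl
      · rw [if_neg hb, mul_zero, sub_zero]
        refine le_trans (le_of_eq ?_) hold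
        rw [← sum_sq_sub_const]
        refine Finset.sum_congr rfl fun x hx => ?_
        rw [mem_box.1 hx]; simp [hb]
    refine (Finset.sum_le_sum fun τ _ => hloc τ).trans ?_
    rw [sum_sub_distrib, ← mul_sum, ← sum_filter]
    have hdrop : ε ^ 2 * n ^ k ≤ ∑ τ with Bad T P τ, ((box P τ).card : ℝ) * d τ ^ 2 := by
      have h1 : ∑ τ with Bad T P τ, (2 * ε * ((T ∩ box P τ).card : ℝ) -
          ε ^ 2 * (box P τ).card) ≤ ∑ τ with Bad T P τ, ((box P τ).card : ℝ) * d τ ^ 2 := by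
        refine Finset.sum_le_sum fun τ _ => ?_
        rw [← density_mul]
        have : (0 : ℝ) ≤ (box P τ).card := by positivity
        nlinarith [mul_nonneg this (sq_nonneg (d τ - ε))]
      rw [sum_sub_distrib, ← mul_sum, ← mul_sum] at h1
      have h2 : ∑ τ with Bad T P τ, ((box P τ).card : ℝ) ≤ n ^ k := by
        refine (sum_le_sum_of_subset_of_nonneg (filter_subset _ univ)
          fun _ _ _ => by positivity).trans ?_
        have := hfib fun _ => 1
        simp only [sum_const, card_univ, Fintype.card_pi, Fintype.card_fin, prod_const,
          nsmul_eq_mul, mul_one] at this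
        rw [← this]; push_cast; rfl
      nlinarith [mul_lt_mul_of_pos_left hbad hε, mul_le_mul_of_nonneg_left h2 (sq_nonneg ε)]
    have h4 : (0 : ℝ) ≤ 1 / (4 * 4 ^ k) := by positivity
    have := mul_le_mul_of_nonneg_left hdrop h4
    linarith

open Classical in
/-- A weak regularity lemma: up to a small proportion of `T`, no box of the partition has a large
subbox in which `T` is much sparser than in the whole box. -/
lemma exists_regular (k : ℕ) {ε : ℝ} (hε : 0 < ε) : ∃ M : ℕ, ∀ (n : ℕ)
    (T : Finset (Fin k → Fin n)), ∃ m ≤ M, ∃ P : Fin n → Fin m,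
      ∑ τ with Bad T P τ, ((T ∩ box P τ).card : ℝ) ≤ ε * n ^ k := by
  set η : ℝ := 1 / (4 * 4 ^ k) * ε ^ 2 with hη
  have hη0 : 0 < η := by positivity
  have key : ∀ j : ℕ, ∃ M : ℕ, ∀ (n : ℕ) (T : Finset (Fin k → Fin n)),
      (∃ m ≤ M, ∃ P : Fin n → Fin m,
        ∑ τ with Bad T P τ, ((T ∩ box P τ).card : ℝ) ≤ ε * n ^ k) ∨
      (∃ m ≤ M, ∃ (P : Fin n → Fin m) (g : (Fin k → Fin n) → ℝ),
        (∀ x y, P ∘ x = P ∘ y → g x = g y) ∧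
        ∑ x, ((if x ∈ T then (1 : ℝ) else 0) - g x) ^ 2 ≤ n ^ k * (1 - j * η)) := by
    intro j
    induction j with
    | zero =>
      refine ⟨1, fun n T => Or.inr ⟨1, le_rfl, fun _ => 0, fun _ => 0, fun _ _ _ => rfl, ?_⟩⟩
      rw [sum_sq_sub_const]
      simp only [inter_univ]
      have := card_le_pow T
      norm_num
      exact this
    | succ j ih =>
      obtain ⟨M, hM⟩ := ih
      refine ⟨M + M * 2 ^ (M ^ k * k), fun n T => ?_⟩
      rcases hM n T with ⟨m, hm, P, hP⟩ | ⟨m, hm, P, g, hg, hcost⟩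
      · exact Or.inl ⟨m, by omega, P, hP⟩
      by_cases hb : ∑ τ with Bad T P τ, ((T ∩ box P τ).card : ℝ) ≤ ε * n ^ k
      · exact Or.inl ⟨m, by omega, P, hb⟩
      obtain ⟨m', hm', P', g', hg', hc⟩ := exists_refinement hm P g hg hε (not_le.1 hb)
      refine Or.inr ⟨m', by omega, P', g', hg', ?_⟩
      push_cast
      rw [← hη] at hc
      linarith
  obtain ⟨j, hj⟩ := exists_nat_gt (1 / η)
  obtain ⟨M, hM⟩ := key j
  refine ⟨M + 1, fun n T => ?_⟩
  rcases hM n T with ⟨m, hm, P, hP⟩ | ⟨m, hm, P, g, hg, hcost⟩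
  · exact ⟨m, by omega, P, hP⟩
  · have h1 : (0 : ℝ) ≤ ∑ x, ((if x ∈ T then (1 : ℝ) else 0) - g x) ^ 2 :=
      Finset.sum_nonneg fun _ _ => sq_nonneg _
    have h2 : 1 < j * η := by rwa [div_lt_iff₀ hη0] at hj
    have h3 : (n : ℝ) ^ k = 0 := by
      have : (0 : ℝ) ≤ (n : ℝ) ^ k := by positivity
      nlinarith
    refine ⟨m, by omega, P, ?_⟩
    rw [h3, mul_zero]
    refine le_of_eq (Finset.sum_eq_zero fun τ _ => ?_)
    have := card_le_pow (T ∩ box P τ)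
    rw [h3] at this
    exact le_antisymm this (by positivity)

@[simp] lemma verts_nil : verts ([] : List (Fin k → Fin n)) = [] := rfl

@[simp] lemma verts_cons (x : Fin k → Fin n) (L : List (Fin k → Fin n)) :
    verts (x :: L) = List.ofFn x ++ verts L := rfl

@[simp] lemma verts_append (L L' : List (Fin k → Fin n)) :
    verts (L ++ L') = verts L ++ verts L' := by simp [verts]

lemma length_verts (L : List (Fin k → Fin n)) : (verts L).length = k * L.length := by
  induction L with
  | nil => simp
  | cons x L ih => rw [verts_cons, List.length_append, ih, List.length_ofFn, List.length_cons]; ring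

/-- In a set of injective points with long lines there are long paths with distinct vertices. -/
lemma exists_path {G : Finset (Fin k → Fin n)} {b : ℝ}
    (hG : ∀ x ∈ G, ∀ i, b ≤ (line G i x).card) (hinj : ∀ x ∈ G, Function.Injective x) (p : ℕ) :
    ∀ U : Finset (Fin n), (U.card : ℝ) + k * p < b → ∀ x ∈ G, ∃ L : List (Fin k → Fin n),
      L.length = p ∧ List.IsChain (Step G) (x :: L) ∧ (verts L).Nodup ∧
      (∀ v ∈ verts L, v ∉ U) ∧ ∀ y ∈ L, y ∈ G := by
  induction p with
  | zero => exact fun U _ x _ => ⟨[], rfl, List.isChain_singleton _, by simp, by simp, by simp⟩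
  | succ p ih =>
    intro U hU x hx
    push_cast at hU
    have hkp : (0 : ℝ) ≤ k * (p + 1) := by positivity
    have hbU : 0 < b - U.card := by
      rcases lt_or_eq_of_le hkp with h | h
      · linarith
      · linarith
    have h1 := pow_le_card_step (d := b - U.card) hbU.le U
      (fun x hx i => by linarith [hG x hx i]) hx
    have h2 : (0 : ℝ) < ((univ.filter fun y => Step G x y ∧ ∀ i, y i ∉ U).card : ℝ) :=
      lt_of_lt_of_le (by positivity) h1
    obtain ⟨y, hy⟩ := card_pos.1 (Nat.cast_pos.1 h2)
    simp only [mem_filter, mem_univ, true_and] at hy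
    have hyc : (univ.image y).card ≤ k := card_image_le.trans (by simp)
    obtain ⟨L, hL, hc, hnd, hLU, hLG⟩ := ih (U ∪ univ.image y) (by
      have : ((U ∪ univ.image y).card : ℝ) ≤ U.card + k := by
        exact_mod_cast (card_union_le _ _).trans (Nat.add_le_add_left hyc _)
      linarith) y hy.1.right
    refine ⟨y :: L, by simp [hL], List.isChain_cons_cons.2 ⟨hy.1, hc⟩, ?_, ?_, ?_⟩
    · rw [verts_cons, List.nodup_append]
      refine ⟨List.nodup_ofFn.2 (hinj y hy.1.right), hnd, fun a ha b hb hab => ?_⟩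
      subst hab
      obtain ⟨i, rfl⟩ := List.mem_ofFn.1 ha
      exact hLU _ hb (mem_union_right _ (mem_image_of_mem _ (mem_univ _)))
    · intro v hv
      rw [verts_cons, List.mem_append, List.mem_ofFn] at hv
      rcases hv with ⟨i, rfl⟩ | hv
      · exact hy.2 i
      · exact fun h => hLU v hv (mem_union_left _ h)
    · intro z hz
      rcases List.mem_cons.1 hz with rfl | hz
      · exact hy.1.right
      · exact hLG z hz

/-- The number of coordinates of `τ` equal to `j`. -/
def multiplicity (τ : Fin k → Fin m) (j : Fin m) : ℕ := (univ.filter fun i => τ i = j).card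

lemma countP_ofFn (P : Fin n → Fin m) (j : Fin m) (x : Fin k → Fin n) :
    (List.ofFn x).countP (fun v => P v = j) = multiplicity (P ∘ x) j := by
  rw [multiplicity, List.ofFn_eq_map, List.countP_map, List.countP_eq_length_filter,
    ← List.toFinset_card_of_nodup ((List.nodup_finRange k).filter _)]
  congr 1
  ext i
  simp

lemma countP_verts_box {P : Fin n → Fin m} {τ : Fin k → Fin m} (j : Fin m)
    {L : List (Fin k → Fin n)} (hL : ∀ x ∈ L, P ∘ x = τ) :
    (verts L).countP (fun v => P v = j) = L.length * multiplicity τ j := by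
  induction L with
  | nil => simp
  | cons x L ih =>
    rw [verts_cons, List.countP_append, countP_ofFn, hL x (by simp),
      ih fun y hy => hL y (by simp [hy]), List.length_cons]
    ring

lemma card_filter_apply_le (T : Finset (Fin k → Fin n)) (i : Fin k) (v : Fin n) :
    (T.filter fun x => x i = v).card ≤ (T.image (proj i)).card := by
  refine card_le_card_of_injOn (proj i) ?_ ?_
  · intro x hx
    exact mem_coe.2 (mem_image_of_mem _ (mem_filter.1 hx).1)
  · intro x hx y hy h
    have hx := (mem_filter.1 hx).2
    have hy := (mem_filter.1 hy).2
    have h := proj_eq_iff.1 h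
    rwa [hy, ← hx, Function.update_eq_self] at h

lemma sum_multiplicity_le (T : Finset (Fin k → Fin n)) (P : Fin n → Fin m) (j : Fin m) :
    ∑ τ, (T ∩ box P τ).card * multiplicity τ j ≤ (cls P j).card * shadowCard T := by
  have h1 : ∀ i : Fin k, (T.filter fun x => P (x i) = j).card ≤
      (cls P j).card * (T.image (proj i)).card := by
    intro i
    have h2 : (T.filter fun x => P (x i) = j) ⊆
        (cls P j).biUnion fun v => T.filter fun x => x i = v := by
      intro x hx
      rw [mem_filter] at hx
      exact mem_biUnion.2 ⟨x i, by simp [cls, hx.2], mem_filter.2 ⟨hx.1, rfl⟩⟩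
    exact (card_le_card h2).trans
      (card_biUnion_le_card_mul _ _ _ fun v _ => card_filter_apply_le T i v)
  calc ∑ τ, (T ∩ box P τ).card * multiplicity τ j
      = ∑ τ, ∑ x ∈ T with P ∘ x = τ, ∑ i, (if P (x i) = j then 1 else 0) := by
        refine Finset.sum_congr rfl fun τ _ => ?_
        have : T ∩ box P τ = T.filter fun x => P ∘ x = τ := by
          ext x; simp [mem_box]
        rw [this, ← smul_eq_mul, ← sum_const]
        refine Finset.sum_congr rfl fun x hx => ?_
        rw [multiplicity, card_filter, ← (mem_filter.1 hx).2]
        rfl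
    _ = ∑ x ∈ T, ∑ i, (if P (x i) = j then 1 else 0) := sum_fiberwise _ _ _
    _ = ∑ i, (T.filter fun x => P (x i) = j).card := by
        rw [sum_comm]; simp only [card_filter]
    _ ≤ ∑ i, (cls P j).card * (T.image (proj i)).card := Finset.sum_le_sum fun i _ => h1 i
    _ = _ := by rw [shadowCard, mul_sum]

/-- The box of `τ` keeps containing paths after three quarters of each class is removed. -/
def Fertile (T : Finset (Fin k → Fin n)) (P : Fin n → Fin m) (p : ℕ) (τ : Fin k → Fin m) : Prop :=
  ∀ A : Fin k → Finset (Fin n), (∀ i, A i ⊆ cls P (τ i)) →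
    (∀ i, (cls P (τ i)).card ≤ 4 * (A i).card) →
    ∃ L : List (Fin k → Fin n), L.length = p ∧ List.IsChain (Step T) L ∧ (verts L).Nodup ∧
      ∀ x ∈ L, x ∈ T ∧ ∀ i, x i ∈ A i

lemma exists_packing_aux {T : Finset (Fin k → Fin n)} (hT : 0 < shadowCard T) (P : Fin n → Fin m)
    (p S : ℕ) : ∀ c : (Fin k → Fin m) → ℕ, ∑ τ, c τ = S → (∀ τ, c τ ≠ 0 → Fertile T P p τ) →
      (∀ τ, 4 * (p * shadowCard T) * c τ ≤ 3 * (T ∩ box P τ).card) →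
      ∃ F : List (List (Fin k → Fin n)), F.length = S ∧
        (∀ L ∈ F, L.length = p ∧ List.IsChain (Step T) L ∧ ∀ x ∈ L, x ∈ T) ∧
        (verts F.flatten).Nodup ∧
        ∀ j, (verts F.flatten).countP (fun v => P v = j) ≤ p * ∑ τ, c τ * multiplicity τ j := by
  induction S with
  | zero => exact fun c _ _ _ => ⟨[], rfl, by simp, by simp, by simp⟩
  | succ S ih =>
    intro c hc hfert hcap
    obtain ⟨τ, -, hτ⟩ := exists_ne_zero_of_sum_ne_zero (by omega : ∑ τ, c τ ≠ 0)
    set c' := Function.update c τ (c τ - 1) with hc'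
    have hle : ∀ σ, c' σ ≤ c σ := by
      intro σ
      by_cases h : σ = τ
      · subst h; simp [hc']
      · simp [hc', h]
    have hceq : ∀ f : (Fin k → Fin m) → ℕ, ∑ σ, c σ * f σ = ∑ σ, c' σ * f σ + f τ := by
      intro f
      rw [← add_sum_erase _ _ (mem_univ τ), ← add_sum_erase univ (fun σ => c' σ * f σ) (mem_univ τ)]
      have h1 : ∑ σ ∈ univ.erase τ, c' σ * f σ = ∑ σ ∈ univ.erase τ, c σ * f σ :=
        Finset.sum_congr rfl fun σ hσ => by
          rw [hc', Function.update_of_ne (mem_erase.1 hσ).1]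
      obtain ⟨a, ha⟩ := Nat.exists_eq_succ_of_ne_zero hτ
      rw [h1, hc', Function.update_self, ha]
      simp only [Nat.succ_eq_add_one, Nat.add_sub_cancel]
      ring
    obtain ⟨F, hF, hFL, hnd, hcount⟩ := ih c' (by have := hceq fun _ => 1; simp at this; omega)
      (fun σ hσ => hfert σ (by have := hle σ; omega))
      (fun σ => (Nat.mul_le_mul_left _ (hle σ)).trans (hcap σ))
    set V := (verts F.flatten).toFinset with hV
    have hload : ∀ j, 4 * (cls P j ∩ V).card ≤ 3 * (cls P j).card := by
      intro j
      have h1 : (cls P j ∩ V).card ≤ (verts F.flatten).countP (fun v => P v = j) := by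
        rw [List.countP_eq_length_filter]
        refine le_trans (card_le_card fun v hv => ?_) (List.toFinset_card_le _)
        simp only [cls, mem_inter, mem_filter, mem_univ, true_and, hV, List.mem_toFinset] at hv
        simp [hv.1, hv.2]
      have h2 := h1.trans (hcount j)
      have h3 : p * ∑ σ, c' σ * multiplicity σ j ≤ p * ∑ σ, c σ * multiplicity σ j :=
        Nat.mul_le_mul_left _ (Finset.sum_le_sum fun σ _ => Nat.mul_le_mul_right _ (hle σ))
      have h4 : 4 * (p * shadowCard T) * ∑ σ, c σ * multiplicity σ j ≤
          3 * ((cls P j).card * shadowCard T) := by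
        rw [mul_sum]
        refine le_trans (Finset.sum_le_sum fun σ _ => ?_)
          (le_trans (le_of_eq (mul_sum _ _ _).symm)
            (Nat.mul_le_mul_left 3 (sum_multiplicity_le T P j)))
        have h5 := Nat.mul_le_mul_right (multiplicity σ j) (hcap σ)
        rwa [mul_assoc _ (c σ), mul_assoc 3] at h5
      refine le_of_mul_le_mul_right ?_ hT
      calc 4 * (cls P j ∩ V).card * shadowCard T
          ≤ 4 * (p * ∑ σ, c σ * multiplicity σ j) * shadowCard T := by gcongr; exact h2.trans h3
        _ = 4 * (p * shadowCard T) * ∑ σ, c σ * multiplicity σ j := by ring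
        _ ≤ _ := h4
        _ = _ := by ring
    obtain ⟨L, hL, hchain, hLnd, hLA⟩ := hfert τ hτ (fun i => cls P (τ i) \ V)
      (fun i => sdiff_subset) (fun i => by
        have h1 := hload (τ i)
        have h2 := card_inter_add_card_sdiff (cls P (τ i)) V
        omega)
    refine ⟨L :: F, by simp [hF], ?_, ?_, ?_⟩
    · intro L' hL'
      rcases List.mem_cons.1 hL' with rfl | h
      · exact ⟨hL, hchain, fun x hx => (hLA x hx).1⟩
      · exact hFL L' h
    · rw [List.flatten_cons, verts_append, List.nodup_append]
      refine ⟨hLnd, hnd, fun a ha b hb hab => ?_⟩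
      subst hab
      obtain ⟨x, hx, i, rfl⟩ := mem_verts.1 ha
      exact (mem_sdiff.1 ((hLA x hx).2 i)).2 (List.mem_toFinset.2 hb)
    · intro j
      rw [List.flatten_cons, verts_append, List.countP_append, hceq, countP_verts_box (τ := τ) j,
        hL, mul_add, add_comm]
      · exact Nat.add_le_add_right (hcount j) _
      · intro x hx
        ext1 i
        have := (mem_sdiff.1 ((hLA x hx).2 i)).1
        simpa [cls] using this

lemma fertile_of_not_bad {T : Finset (Fin k → Fin n)} (hk : 0 < k)
    (hinj : ∀ x ∈ T, Function.Injective x)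
    {P : Fin n → Fin m} {p : ℕ} {τ : Fin k → Fin m} {d : ℝ} (hn : 0 < n) (hd : 0 < d)
    (hp : 1 ≤ p) (hpn : (k : ℝ) * p < d / (2 * k) * n) (hbad : ¬ Bad T P τ)
    (hτ : 2 * 4 ^ k * d * n ^ k ≤ ((T ∩ box P τ).card : ℝ)) : Fertile T P p τ := by
  intro A hA hA4
  have h1 : (T ∩ box P τ).card ≤ 2 * 4 ^ k * (T ∩ Fintype.piFinset A).card := by
    by_contra h
    exact hbad ⟨A, hA, hA4, not_le.1 h⟩
  have h2 : d * n ^ k ≤ ((T ∩ Fintype.piFinset A).card : ℝ) := by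
    have h3 : ((T ∩ box P τ).card : ℝ) ≤ 2 * 4 ^ k * (T ∩ Fintype.piFinset A).card := by
      exact_mod_cast h1
    have h4 : (2 * 4 ^ k : ℝ) * (d * n ^ k) ≤ 2 * 4 ^ k * (T ∩ Fintype.piFinset A).card := by
      linarith
    exact le_of_mul_le_mul_left h4 (by positivity)
  have hk' : (0 : ℝ) < k := by exact_mod_cast hk
  have hn' : (0 : ℝ) < n := by exact_mod_cast hn
  obtain ⟨G, hG, hline, hGc⟩ := exists_clean (T ∩ Fintype.piFinset A) (d := d / (2 * k) * n)
    (by positivity)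
  have hnk : (n : ℝ) ^ k = n * n ^ (k - 1) := by rw [← pow_succ', Nat.sub_add_cancel hk]
  have h5 : (0 : ℝ) < G.card := by
    have h6 : d / (2 * k) * n * (k * n ^ (k - 1)) = d * (n : ℝ) ^ k / 2 := by
      rw [hnk]; field_simp
    have : 0 < d * (n : ℝ) ^ k := by positivity
    linarith
  obtain ⟨x, hx⟩ := card_pos.1 (Nat.cast_pos.1 h5)
  have hGT : G ⊆ T := hG.trans inter_subset_left
  have hxc : (univ.image x).card ≤ k := card_image_le.trans (by simp)
  obtain ⟨L, hL, hchain, hnd, hLU, hLG⟩ := exists_path hline (fun y hy => hinj y (hGT hy)) (p - 1)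
    (univ.image x) (by
      have : ((univ.image x).card : ℝ) ≤ k := by exact_mod_cast hxc
      push_cast [Nat.cast_sub hp]
      linarith) x hx
  refine ⟨x :: L, by simp [hL]; omega, hchain.imp fun _ _ h => h.mono hGT, ?_, ?_⟩
  · rw [verts_cons, List.nodup_append]
    refine ⟨List.nodup_ofFn.2 (hinj x (hGT hx)), hnd, fun a ha b hb hab => ?_⟩
    subst hab
    obtain ⟨i, rfl⟩ := List.mem_ofFn.1 ha
    exact hLU _ hb (mem_image_of_mem _ (mem_univ _))
  · intro y hy
    have hy' : y ∈ G := by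
      rcases List.mem_cons.1 hy with rfl | h
      · exact hx
      · exact hLG y h
    have := mem_inter.1 (hG hy')
    exact ⟨this.1, Fintype.mem_piFinset.1 this.2⟩

/-- Most of the possible length can be covered by disjoint paths of linear length. -/
lemma exists_packing (hk : 0 < k) {ε : ℝ} (hε : 0 < ε) : ∃ θ : ℝ, 0 < θ ∧ ∃ K : ℕ, ∀ n : ℕ,
    ∀ T : Finset (Fin k → Fin n), T.Nonempty → (∀ x ∈ T, Function.Injective x) →
    ∀ p : ℕ, 1 ≤ p → (k : ℝ) * p < θ * n → ∃ F : List (List (Fin k → Fin n)),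
      (∀ L ∈ F, L.length = p ∧ List.IsChain (Step T) L ∧ ∀ x ∈ L, x ∈ T) ∧
      (verts F.flatten).Nodup ∧
      3 * ((T.card : ℝ) - 2 * ε * n ^ k) ≤ 4 * (p * (F.length + K)) * shadowCard T := by
  classical
  obtain ⟨M, hM⟩ := exists_regular k hε
  set d : ℝ := ε / (M + 1) ^ k / (2 * 4 ^ k) with hd
  have hk' : (0 : ℝ) < k := by exact_mod_cast hk
  refine ⟨d / (2 * k), by positivity, (M + 1) ^ k, fun n T hT hinj p hp hpn => ?_⟩
  obtain ⟨m, hm, P, hP⟩ := hM n T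
  have hD := shadowCard_pos hk hT
  have hn : 0 < n := by
    rcases Nat.eq_zero_or_pos n with rfl | h
    · obtain ⟨x, -⟩ := hT
      exact (x ⟨0, hk⟩).elim0
    · exact h
  set good : (Fin k → Fin m) → Prop := fun τ =>
    ¬ Bad T P τ ∧ ε / (M + 1) ^ k * n ^ k ≤ ((T ∩ box P τ).card : ℝ) with hgood
  set c : (Fin k → Fin m) → ℕ := fun τ =>
    if good τ then 3 * (T ∩ box P τ).card / (4 * (p * shadowCard T)) else 0 with hc
  obtain ⟨F, hF, hFL, hnd, -⟩ := exists_packing_aux hD P p (∑ τ, c τ) c rfl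
    (fun τ hτ => by
      have hg : good τ := by
        by_contra h
        exact hτ (if_neg h)
      refine fertile_of_not_bad hk hinj hn (d := d) (by positivity) hp hpn hg.1 ?_
      refine le_trans (le_of_eq ?_) hg.2
      rw [hd]; field_simp)
    (fun τ => by
      simp only [hc]
      split_ifs
      · exact Nat.mul_div_le _ _
      · simp)
  refine ⟨F, hFL, hnd, ?_⟩
  have hcard : Fintype.card (Fin k → Fin m) ≤ (M + 1) ^ k := by
    simp only [Fintype.card_pi, Fintype.card_fin, prod_const, card_univ]
    exact Nat.pow_le_pow_left (by omega) _
  have hcard' : (Fintype.card (Fin k → Fin m) : ℝ) ≤ (M + 1) ^ k := by exact_mod_cast hcard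
  have hTsum : (T.card : ℝ) = ∑ τ, ((T ∩ box P τ).card : ℝ) := by
    rw [← Nat.cast_sum]
    congr 1
    rw [card_eq_sum_card_fiberwise (f := fun x => P ∘ x) (t := univ) (by simp)]
    refine Finset.sum_congr rfl fun τ _ => ?_
    congr 1
    ext x; simp [mem_box]
  set E : ℝ := 4 * (p * shadowCard T) with hE
  have hE0 : 0 < E := by
    have : (0 : ℝ) < p := by exact_mod_cast hp
    have : (0 : ℝ) < shadowCard T := by exact_mod_cast hD
    positivity
  have hpt : ∀ τ, 3 * ((T ∩ box P τ).card : ℝ) ≤ E * (c τ + 1) +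
      3 * ((if Bad T P τ then ((T ∩ box P τ).card : ℝ) else 0) + ε / (M + 1) ^ k * n ^ k) := by
    intro τ
    have hpos : (0 : ℝ) ≤ ε / (M + 1) ^ k * n ^ k := by positivity
    have hc0 : 0 ≤ E * ((c τ : ℝ) + 1) := by positivity
    by_cases hb : Bad T P τ
    · rw [if_pos hb]; linarith
    · rw [if_neg hb]
      by_cases hg : ε / (M + 1) ^ k * n ^ k ≤ ((T ∩ box P τ).card : ℝ)
      · have h1 : c τ = 3 * (T ∩ box P τ).card / (4 * (p * shadowCard T)) := if_pos ⟨hb, hg⟩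
        have h2 : 3 * (T ∩ box P τ).card < 4 * (p * shadowCard T) * (c τ + 1) := by
          rw [h1]
          exact Nat.lt_mul_div_succ _ (by positivity)
        have h3 : 3 * ((T ∩ box P τ).card : ℝ) < E * (c τ + 1) := by
          rw [hE]; exact_mod_cast h2
        linarith
      · linarith
  have hsum := Finset.sum_le_sum fun τ (_ : τ ∈ univ) => hpt τ
  rw [← mul_sum, ← hTsum, sum_add_distrib, ← mul_sum, ← mul_sum, sum_add_distrib, sum_add_distrib,
    ← sum_filter] at hsum
  simp only [sum_const, card_univ, nsmul_eq_mul, mul_one] at hsum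
  rw [← Nat.cast_sum, ← hF] at hsum
  have h1 : (Fintype.card (Fin k → Fin m) : ℝ) * (ε / (M + 1) ^ k * n ^ k) ≤ ε * n ^ k := by
    calc (Fintype.card (Fin k → Fin m) : ℝ) * (ε / (M + 1) ^ k * n ^ k)
        ≤ (M + 1) ^ k * (ε / (M + 1) ^ k * n ^ k) := by gcongr
      _ = _ := by field_simp
  have h2 : E * (F.length + Fintype.card (Fin k → Fin m)) ≤ E * (F.length + (M + 1) ^ k) := by
    gcongr
  push_cast
  have h3 : 4 * ((p : ℝ) * (F.length + (M + 1) ^ k)) * shadowCard T =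
      E * (F.length + (M + 1) ^ k) := by rw [hE]; ring
  rw [h3]
  linarith

lemma verts_sublist {L L' : List (Fin k → Fin n)} (h : L.Sublist L') :
    (verts L).Sublist (verts L') := h.flatMap _

/-- Consecutive points of a walk give consecutive edges of a tight walk. -/
lemma image_window_eq_image_mix (hk : 0 < k) (u : ℕ → Fin k → Fin n) (a j : ℕ) (hj : j < k) :
    (range k).image (fun t => u ((a * k + j + t) / k) ⟨(a * k + j + t) % k, Nat.mod_lt _ hk⟩) =
      univ.image (mix j (u (a + 1)) (u a)) := by
  have low : ∀ l (hl : l < k), u ((a * k + l) / k) ⟨(a * k + l) % k, Nat.mod_lt _ hk⟩ =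
      u a ⟨l, hl⟩ := by
    intro l hl
    have h1 : (a * k + l) / k = a := by
      rw [add_comm, Nat.add_mul_div_right _ _ hk, Nat.div_eq_of_lt hl, zero_add]
    have h2 : (a * k + l) % k = l := by
      rw [add_comm, Nat.add_mul_mod_self_right, Nat.mod_eq_of_lt hl]
    rw [h1]; congr 1; exact Fin.ext h2
  have high : ∀ l (hl : l < k), u ((a * k + (k + l)) / k)
      ⟨(a * k + (k + l)) % k, Nat.mod_lt _ hk⟩ = u (a + 1) ⟨l, hl⟩ := by
    intro l hl
    have h1 : (a * k + (k + l)) / k = a + 1 := by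
      rw [← add_assoc, ← Nat.succ_mul, add_comm, Nat.add_mul_div_right _ _ hk,
        Nat.div_eq_of_lt hl, zero_add]
    have h2 : (a * k + (k + l)) % k = l := by
      rw [← add_assoc, ← Nat.succ_mul, add_comm, Nat.add_mul_mod_self_right, Nat.mod_eq_of_lt hl]
    rw [h1]; congr 1; exact Fin.ext h2
  ext v
  simp only [mem_image, mem_range, mem_univ, true_and]
  constructor
  · rintro ⟨t, ht, rfl⟩
    by_cases h : j + t < k
    · refine ⟨⟨j + t, h⟩, ?_⟩
      have := low (j + t) h
      simp only [← add_assoc] at this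
      rw [this]
      simp [mix]
    · obtain ⟨l, hl⟩ := Nat.exists_eq_add_of_le (not_lt.1 h)
      refine ⟨⟨l, by omega⟩, ?_⟩
      have := high l (by omega)
      rw [← hl] at this
      simp only [← add_assoc] at this
      rw [this]
      have : l < j := by omega
      simp [mix, this]
  · rintro ⟨⟨l, hl⟩, rfl⟩
    by_cases h : l < j
    · refine ⟨k + l - j, by omega, ?_⟩
      have h1 : a * k + j + (k + l - j) = a * k + (k + l) := by omega
      simp only [h1, high l hl]
      simp [mix, h]
    · refine ⟨l - j, by omega, ?_⟩
      have h1 : a * k + j + (l - j) = a * k + l := by omega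
      simp only [h1, low l hl]
      simp [mix, h]

/-- A closed walk with distinct vertices traces a monochromatic tight cycle. -/
lemma monoTightCycle_of_isChain (hk : 0 < k) {α : Type*} {χ : Finset (Fin n) → α} {c : α}
    {T : Finset (Fin k → Fin n)} (hT : ∀ x ∈ T, χ (univ.image x) = c) {x : Fin k → Fin n}
    {L : List (Fin k → Fin n)} (hL : List.IsChain (Step T) (x :: (L ++ [x])))
    (hnd : (verts (x :: L)).Nodup) :
    (verts (x :: L)).toFinset.card = k * (L.length + 1) ∧
      MonoTightCycle k χ (verts (x :: L)).toFinset := by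
  have hcard : (verts (x :: L)).toFinset.card = k * (L.length + 1) := by
    rw [List.toFinset_card_of_nodup hnd, length_verts, List.length_cons]
  refine ⟨hcard, Or.inr ?_⟩
  set m := L.length + 1 with hm
  have hm0 : 0 < m := Nat.succ_pos _
  have hlen : (x :: L).length = m := rfl
  let u : ℕ → Fin k → Fin n := fun a => (x :: L)[a % m]'(hlen ▸ Nat.mod_lt _ hm0)
  have hu : ∀ a, Step T (u a) (u (a + 1)) := by
    intro a
    have ha := Nat.mod_lt a hm0
    have h1 := hL.getElem (a % m) (by simp; omega)
    have h2 : (x :: (L ++ [x]))[a % m]'(by simp; omega) = u a := by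
      simp only [u, ← List.cons_append]
      rw [List.getElem_append_left]
    have h3 : (x :: (L ++ [x]))[a % m + 1]'(by simp; omega) = u (a + 1) := by
      simp only [u, ← List.cons_append]
      by_cases h : a % m + 1 < m
      · have h4 : (a + 1) % m = a % m + 1 := by
          rw [Nat.add_mod, Nat.mod_eq_of_lt (show 1 < m by omega), Nat.mod_eq_of_lt h]
        simp only [h4]
        rw [List.getElem_append_left (by rw [hlen]; exact h)]
      · have h4 : a % m + 1 = m := by omega
        have h5 : (a + 1) % m = 0 := by
          rw [← Nat.mod_add_mod, h4, Nat.mod_self]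
        simp only [h5, h4]
        rw [List.getElem_append_right (by rw [hlen])]
        simp [hlen]
    rwa [h2, h3] at h1
  set g : ℕ → Fin n := fun i => u (i / k) ⟨i % k, Nat.mod_lt _ hk⟩ with hg
  have hgu : ∀ {i a j} (hj : j < k), i / k = a → i % k = j → g i = u a ⟨j, hj⟩ := by
    rintro i a j hj rfl rfl; rfl
  have hum : ∀ {a b}, a % m = b % m → u a = u b := by
    intro a b h; simp only [u, h]
  have himage : (range (k * m)).image g = (verts (x :: L)).toFinset := by
    ext v
    simp only [mem_image, mem_range, List.mem_toFinset, mem_verts]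
    constructor
    · rintro ⟨i, hi, rfl⟩
      exact ⟨_, List.getElem_mem _, _, rfl⟩
    · rintro ⟨y, hy, i, rfl⟩
      obtain ⟨a, ha, rfl⟩ := List.getElem_of_mem hy
      rw [hlen] at ha
      refine ⟨k * a + i, ?_, ?_⟩
      · calc k * a + i < k * a + k := by have := i.2; omega
          _ = k * (a + 1) := by ring
          _ ≤ k * m := Nat.mul_le_mul_left _ ha
      · have h1 : (k * a + i) / k = a := by
          rw [Nat.mul_add_div hk, Nat.div_eq_of_lt i.2, add_zero]
        have h2 : (k * a + i) % k = i := by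
          rw [Nat.mul_add_mod, Nat.mod_eq_of_lt i.2]
        rw [hgu i.2 h1 h2]
        have hua : ∀ {b} (hb : b < (x :: L).length), a % m = b → u a = (x :: L)[b] := by
          rintro _ _ rfl; rfl
        rw [hua _ (Nat.mod_eq_of_lt ha)]
  refine ⟨g, c, ?_, ?_, ?_, ?_⟩
  · intro i
    rw [hcard]
    have h1 : (i + k * m) / k = i / k + m := by
      rw [mul_comm, Nat.add_mul_div_right _ _ hk]
    have h2 : (i + k * m) % k = i % k := by
      rw [Nat.add_mul_mod_self_left]
    rw [hgu (Nat.mod_lt _ hk) h1 h2, hum (Nat.add_mod_right _ _)]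
  · rw [hcard]
    have : Set.InjOn g (range (k * m)) := by
      rw [← card_image_iff, himage, hcard, card_range]
    simpa using this
  · rw [hcard, himage]
  · intro i
    have h1 := image_window_eq_image_mix hk u (i / k) (i % k) (Nat.mod_lt _ hk)
    have h2 : i / k * k + i % k = i := Nat.div_add_mod' i k
    simp only [h2] at h1
    rw [hg]
    rw [h1]
    exact hT _ (hu _ _ (Nat.mod_lt _ hk).le)

lemma isChain_of_forall {T : Finset (Fin k → Fin n)} {B : List (Fin k → Fin n)}
    (h : ∀ x ∈ B, ∀ y ∈ B, Step T x y) : List.IsChain (Step T) B :=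
  (List.pairwise_of_forall_mem_list h).isChain

/-- A dense set contains many points, any two of which are joined by a step. -/
lemma exists_hub (k t : ℕ) {δ : ℝ} (hδ : 0 < δ) : ∃ n₀ : ℕ, ∀ n ≥ n₀,
    ∀ T : Finset (Fin k → Fin n), (∀ x ∈ T, Function.Injective x) → δ * n ^ k ≤ T.card →
      ∃ B : List (Fin k → Fin n), B.length = t ∧ (∀ x ∈ B, ∀ y ∈ B, Step T x y) ∧
        (verts B).Nodup := by
  obtain ⟨n₀, h⟩ := exists_box k t hδ
  refine ⟨n₀, fun n hn T hT hcard => ?_⟩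
  obtain ⟨A, hA, hAT⟩ := h n hn T hcard
  set b : Fin t → Fin k → Fin n := fun a i => (A i).orderEmbOfFin (hA i) a with hb
  have hmem : ∀ a i, b a i ∈ A i := fun a i => orderEmbOfFin_mem _ _ _
  refine ⟨List.ofFn b, by simp, ?_, nodup_verts_ofFn ?_⟩
  · intro x hx y hy j _
    obtain ⟨a, rfl⟩ := List.mem_ofFn.1 hx
    obtain ⟨a', rfl⟩ := List.mem_ofFn.1 hy
    refine hAT (Fintype.mem_piFinset.2 fun i => ?_)
    rw [mix]
    split_ifs
    exacts [hmem _ _, hmem _ _]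
  · rintro ⟨a, i⟩ ⟨a', i'⟩ h
    simp only at h
    have hii : i = i' := by
      by_contra hne
      have hx : Function.update (b a) i' (b a' i') ∈ T := by
        refine hAT (Fintype.mem_piFinset.2 fun l => ?_)
        by_cases hl : l = i'
        · subst hl; simp [hmem]
        · simp [hl, hmem]
      refine hne (hT _ hx ?_)
      rw [Function.update_of_ne hne, Function.update_self, h]
    subst hii
    have : a = a' := ((A i).orderEmbOfFin (hA i)).injective h
    rw [this]

/-- Disjoint paths are linked into a single one through disjoint joining sets. -/
lemma exists_long_path {T : Finset (Fin k → Fin n)} {M q : ℕ} {Z : ℕ → Finset (Fin n)}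
    (hZ : ∀ a b, a ≠ b → Disjoint (Z a) (Z b)) (hJ : ∀ a < q, Joins T M (Z a))
    (F : List (List (Fin k → Fin n))) (hFq : F.length ≤ q)
    (hF : ∀ L ∈ F, List.IsChain (Step T) L ∧ ∀ x ∈ L, x ∈ T) (hnd : (verts F.flatten).Nodup)
    (hFZ : ∀ v ∈ verts F.flatten, ∀ a < q, v ∉ Z a) :
    ∃ P : List (Fin k → Fin n), List.IsChain (Step T) P ∧ (∀ x ∈ P, x ∈ T) ∧ (verts P).Nodup ∧
      F.flatten.length ≤ P.length ∧
      ∀ v ∈ verts P, v ∈ verts F.flatten ∨ ∃ a < F.length, v ∈ Z a := by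
  induction F with
  | nil => exact ⟨[], by simp⟩
  | cons L F ih =>
    rw [List.flatten_cons, verts_append] at hnd hFZ
    rw [List.length_cons] at hFq
    obtain ⟨P, hP, hPT, hPnd, hPlen, hPv⟩ := ih (by omega)
      (fun L' hL' => hF L' (List.mem_cons_of_mem _ hL')) (List.nodup_append.1 hnd).2.1
      (fun v hv => hFZ v (List.mem_append_right _ hv))
    obtain ⟨hLc, hLT⟩ := hF L (List.mem_cons_self)
    rw [List.flatten_cons, verts_append]
    rcases List.eq_nil_or_concat L with rfl | ⟨L₀, y, rfl⟩
    · refine ⟨P, hP, hPT, hPnd, by simpa using hPlen, fun v hv => ?_⟩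
      rcases hPv v hv with h | ⟨a, ha, h⟩
      · exact Or.inl (List.mem_append_right _ h)
      · exact Or.inr ⟨a, by simp; omega, h⟩
    rw [List.concat_eq_append] at *
    cases P with
    | nil =>
      have h0 : F.flatten.length = 0 := by simpa using hPlen
      refine ⟨L₀ ++ [y], hLc, hLT, (List.nodup_append.1 hnd).1, ?_, fun v hv => ?_⟩
      · rw [List.length_append (as := L₀ ++ [y]), h0]; simp
      · exact Or.inl (List.mem_append_left _ hv)
    | cons x P =>
      obtain ⟨C, -, hC, hCnd, hCZ⟩ := hJ F.length (by omega) y (hLT y (by simp)) x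
        (hPT x (by simp))
      have hCT : ∀ z ∈ C, z ∈ T := by
        intro z hz
        obtain ⟨C₁, C₂, rfl⟩ := List.append_of_mem hz
        rw [List.append_assoc, List.cons_append, ← List.cons_append, List.isChain_split] at hC
        cases C₂ with
        | nil => exact (List.isChain_cons_cons.1 hC.2).1.left
        | cons w C₂ => exact (List.isChain_cons_cons.1 hC.2).1.left
      refine ⟨L₀ ++ y :: (C ++ x :: P), ?_, ?_, ?_, ?_, ?_⟩
      · rw [List.isChain_split]
        refine ⟨hLc, ?_⟩
        rw [← List.cons_append, List.isChain_split]
        exact ⟨by simpa using hC, hP⟩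
      · intro z hz
        simp only [List.mem_append, List.mem_cons] at hz
        rcases hz with h | rfl | h | rfl | h
        · exact hLT z (by simp [h])
        · exact hLT z (by simp)
        · exact hCT z h
        · exact hPT z (by simp)
        · exact hPT z (by simp [h])
      · have e : L₀ ++ y :: (C ++ x :: P) = (L₀ ++ [y]) ++ (C ++ (x :: P)) := by simp
        rw [e, verts_append, verts_append C]
        have hd := List.disjoint_of_nodup_append hnd
        rw [List.nodup_append']
        refine ⟨(List.nodup_append.1 hnd).1, ?_, ?_⟩
        · rw [List.nodup_append']
          refine ⟨hCnd, hPnd, fun v hv hv' => ?_⟩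
          rcases hPv v hv' with h | ⟨a, ha, h⟩
          · exact hFZ v (List.mem_append_right _ h) _ (by omega) (hCZ v hv)
          · exact disjoint_left.1 (hZ F.length a (by omega)) (hCZ v hv) h
        · intro v hv hv'
          rcases List.mem_append.1 hv' with h | h
          · exact hFZ v (List.mem_append_left _ hv) _ (by omega) (hCZ v h)
          · rcases hPv v h with h | ⟨a, ha, h⟩
            · exact hd hv h
            · exact hFZ v (List.mem_append_left _ hv) _ (by omega) h
      · simp only [List.length_append, List.length_cons, List.length_nil] at hPlen ⊢
        omega
      · intro v hv
        have e : L₀ ++ y :: (C ++ x :: P) = (L₀ ++ [y]) ++ (C ++ (x :: P)) := by simp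
        rw [e, verts_append, verts_append C, List.mem_append, List.mem_append] at hv
        rw [List.mem_append, List.length_cons]
        rcases hv with h | h | h
        · exact Or.inl (Or.inl h)
        · exact Or.inr ⟨_, by omega, hCZ v h⟩
        · rcases hPv v h with h | ⟨a, ha, h⟩
          · exact Or.inl (Or.inr h)
          · exact Or.inr ⟨a, by omega, h⟩

/-- A path, a hub and two joining sets yield closed walks of all lengths up to that of the path. -/
lemma exists_closed_walk {T : Finset (Fin k → Fin n)} {M : ℕ} {Z Z' : Finset (Fin n)}
    (hZ : Joins T M Z) (hZ' : Joins T M Z') {P B : List (Fin k → Fin n)}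
    (hP : List.IsChain (Step T) P) (hPT : ∀ x ∈ P, x ∈ T) (hPnd : (verts P).Nodup)
    (hB : ∀ x ∈ B, ∀ y ∈ B, Step T x y) (hBlen : B.length = 2 * M + 2) (hBnd : (verts B).Nodup)
    (hPB : ∀ v ∈ verts P, v ∉ verts B) (hPZ : ∀ v ∈ verts P, v ∉ Z) (hPZ' : ∀ v ∈ verts P, v ∉ Z')
    (hBZ : ∀ v ∈ verts B, v ∉ Z) (hBZ' : ∀ v ∈ verts B, v ∉ Z') (hZZ' : Disjoint Z Z')
    {m : ℕ} (hm : 1 ≤ m) (hmP : m ≤ P.length) :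
    ∃ (x : Fin k → Fin n) (L : List (Fin k → Fin n)), L.length + 1 = m ∧
      List.IsChain (Step T) (x :: (L ++ [x])) ∧ (verts (x :: L)).Nodup ∧
      ∀ v ∈ verts (x :: L), v ∈ verts P ∨ v ∈ verts B ∨ v ∈ Z ∨ v ∈ Z' := by
  obtain ⟨s, e, B, rfl⟩ : ∃ s e B', B = s :: e :: B' := by
    match B, hBlen with
    | s :: e :: B', _ => exact ⟨s, e, B', rfl⟩
  simp only [List.length_cons] at hBlen
  rcases le_or_gt m (2 * M + 2) with h | h
  · refine ⟨s, (e :: B).take (m - 1), by simp; omega, isChain_of_forall ?_, ?_, ?_⟩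
    · have key : ∀ z ∈ s :: ((e :: B).take (m - 1) ++ [s]), z ∈ s :: e :: B := by
        intro z hz
        simp only [List.mem_cons, List.mem_append, List.not_mem_nil, or_false] at hz
        rcases hz with rfl | h | rfl
        · simp
        · exact List.mem_cons_of_mem _ (List.mem_of_mem_take h)
        · simp
      exact fun x hx y hy => hB x (key x hx) y (key y hy)
    · exact hBnd.sublist (verts_sublist ((List.take_sublist _ _).cons_cons s))
    · intro v hv
      exact Or.inr (Or.inl ((verts_sublist ((List.take_sublist _ _).cons_cons s)).subset hv))
  · set P₁ := P.take (m - (2 * M + 2)) with hP₁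
    have hsub : P₁.Sublist P := List.take_sublist _ _
    have hP₁c : List.IsChain (Step T) P₁ := hP.take _
    have hlen₁ : P₁.length = m - (2 * M + 2) := by rw [hP₁, List.length_take]; omega
    have hv₁ : ∀ v ∈ verts P₁, v ∈ verts P := fun v hv => (verts_sublist hsub).subset hv
    have hnd₁ := hPnd.sublist (verts_sublist hsub)
    clear_value P₁
    obtain ⟨P₀, y, rfl⟩ : ∃ P₀ y, P₁ = P₀ ++ [y] := by
      rcases List.eq_nil_or_concat P₁ with rfl | ⟨P₀, y, rfl⟩
      · simp at hlen₁; omega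
      · exact ⟨P₀, y, List.concat_eq_append⟩
    obtain ⟨x, P₂, hx⟩ : ∃ x P₂, P₀ ++ [y] = x :: P₂ := List.exists_cons_of_ne_nil (by simp)
    have hsT : s ∈ T := (hB s (by simp) s (by simp)).left
    have heT : e ∈ T := (hB e (by simp) e (by simp)).left
    have hxT : x ∈ T := hPT x (hsub.subset (by simp [hx]))
    have hyT : y ∈ T := hPT y (hsub.subset (by simp))
    obtain ⟨C, hClen, hC, hCnd, hCZ⟩ := hZ y hyT s hsT
    obtain ⟨C', hClen', hC', hCnd', hCZ'⟩ := hZ' e heT x hxT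
    set B₁ := B.take (2 * M - C.length - C'.length) with hB₁
    have hB₁len : B₁.length = 2 * M - C.length - C'.length := by
      rw [hB₁, List.length_take]; omega
    have hB₁B : B₁.Sublist B := List.take_sublist _ _
    have hmemB : ∀ z ∈ s :: (B₁ ++ [e]), z ∈ s :: e :: B := by
      intro z hz
      simp only [List.mem_cons, List.mem_append, List.not_mem_nil, or_false] at hz ⊢
      rcases hz with h | h | h
      · exact Or.inl h
      · exact Or.inr (Or.inr (hB₁B.subset h))
      · exact Or.inr (Or.inl h)
    have hperm : (s :: (B₁ ++ [e])).Perm (s :: e :: B₁) :=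
      (List.perm_append_singleton e B₁).cons s
    have hhub : (verts (s :: (B₁ ++ [e]))).Nodup :=
      (hperm.flatMap_right _).nodup_iff.2
        (hBnd.sublist (verts_sublist ((hB₁B.cons_cons e).cons_cons s)))
    have hhubv : ∀ v ∈ verts (s :: (B₁ ++ [e])), v ∈ verts (s :: e :: B) := by
      intro v hv
      obtain ⟨z, hz, i, rfl⟩ := mem_verts.1 hv
      exact mem_verts.2 ⟨z, hmemB z hz, i, rfl⟩
    have heq : x :: (P₂ ++ (C ++ ((s :: (B₁ ++ [e])) ++ C'))) =
        (P₀ ++ [y]) ++ (C ++ ((s :: (B₁ ++ [e])) ++ C')) := by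
      rw [hx]; rfl
    have hlen₂ := congrArg List.length hx
    simp only [List.length_append, List.length_cons, List.length_nil] at hlen₁ hlen₂
    refine ⟨x, P₂ ++ (C ++ ((s :: (B₁ ++ [e])) ++ C')), ?_, ?_, ?_, ?_⟩
    · simp only [List.length_append, List.length_cons, List.length_nil]
      omega
    · have heq' : x :: ((P₂ ++ (C ++ ((s :: (B₁ ++ [e])) ++ C'))) ++ [x]) =
          P₀ ++ y :: (C ++ s :: (B₁ ++ e :: (C' ++ [x]))) := by
        rw [← List.cons_append, heq]; simp
      rw [heq', List.isChain_split]
      refine ⟨hP₁c, ?_⟩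
      rw [← List.cons_append, List.isChain_split]
      refine ⟨by simpa using hC, ?_⟩
      rw [← List.cons_append, List.isChain_split]
      exact ⟨isChain_of_forall fun a ha b hb => hB a (hmemB a ha) b (hmemB b hb), hC'⟩
    · rw [heq, verts_append, verts_append C, verts_append (s :: (B₁ ++ [e])), List.nodup_append',
        List.nodup_append', List.nodup_append']
      refine ⟨hnd₁, ⟨hCnd, ⟨hhub, hCnd', ?_⟩, ?_⟩, ?_⟩
      · exact fun v hv hv' => hBZ' v (hhubv v hv) (hCZ' v hv')
      · intro v hv hv'
        rcases List.mem_append.1 hv' with h | h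
        · exact hBZ v (hhubv v h) (hCZ v hv)
        · exact disjoint_left.1 hZZ' (hCZ v hv) (hCZ' v h)
      · intro v hv hv'
        rcases List.mem_append.1 hv' with h | h
        · exact hPZ v (hv₁ v hv) (hCZ v h)
        rcases List.mem_append.1 h with h | h
        · exact hPB v (hv₁ v hv) (hhubv v h)
        · exact hPZ' v (hv₁ v hv) (hCZ' v h)
    · intro v hv
      rw [heq, verts_append, verts_append C, verts_append (s :: (B₁ ++ [e]))] at hv
      simp only [List.mem_append] at hv
      rcases hv with h | h | h | h
      · exact Or.inl (hv₁ v h)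
      · exact Or.inr (Or.inr (Or.inl (hCZ v h)))
      · exact Or.inr (Or.inl (hhubv v h))
      · exact Or.inr (Or.inr (Or.inr (hCZ' v h)))

lemma card_le_card_avoid (T : Finset (Fin k → Fin n)) (U : Finset (Fin n)) :
    T.card ≤ (T.filter fun x => ∀ i, x i ∉ U).card + U.card * shadowCard T := by
  have h1 : (T.filter fun x => ¬ ∀ i, x i ∉ U) ⊆
      univ.biUnion fun i => U.biUnion fun v => T.filter fun x => x i = v := by
    intro x hx
    rw [mem_filter] at hx
    push Not at hx
    obtain ⟨hxT, i, hi⟩ := hx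
    exact mem_biUnion.2 ⟨i, mem_univ _, mem_biUnion.2 ⟨_, hi, mem_filter.2 ⟨hxT, rfl⟩⟩⟩
  have h2 : (T.filter fun x => ¬ ∀ i, x i ∉ U).card ≤ U.card * shadowCard T := by
    rw [shadowCard, mul_sum]
    exact (card_le_card h1).trans (card_biUnion_le.trans (Finset.sum_le_sum fun i _ =>
      card_biUnion_le_card_mul _ _ _ fun v _ => card_filter_apply_le T i v))
  have h3 := card_filter_add_card_filter_not (s := T) (fun x => ∀ i, x i ∉ U)
  omega

lemma card_filter_injective_ge (hn : 10 * (k : ℝ) ^ 2 ≤ n) (hk : 0 < k) :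
    9 / 10 * (n : ℝ) ^ k ≤
      ((univ.filter fun x : Fin k → Fin n => Function.Injective x).card : ℝ) := by
  have hk1 : (1 : ℝ) ≤ k := by exact_mod_cast hk
  have hkn : (k : ℝ) ≤ n := by nlinarith
  have hn0 : (0 : ℝ) < n := by linarith
  have h1 : (univ.filter fun x : Fin k → Fin n => Function.Injective x).card =
      n.descFactorial k := by
    rw [← Fintype.card_subtype, Fintype.card_congr (Equiv.subtypeInjectiveEquivEmbedding _ _),
      Fintype.card_embedding_eq, Fintype.card_fin, Fintype.card_fin]
  rw [h1]
  have h2 : (((n + 1 - k : ℕ) : ℝ)) ^ k ≤ n.descFactorial k := by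
    exact_mod_cast Nat.pow_sub_le_descFactorial n k
  refine le_trans ?_ h2
  have h3 : (n : ℝ) * (1 + -(k / n)) ≤ ((n + 1 - k : ℕ) : ℝ) := by
    have : k ≤ n := by exact_mod_cast hkn
    rw [Nat.cast_sub (by omega)]
    push_cast
    field_simp
    linarith
  have h4 : (k : ℝ) / n ≤ 1 := by rwa [div_le_one hn0]
  have h5 := one_add_mul_le_pow (a := -((k : ℝ) / n)) (by linarith) k
  have h6 : (k : ℝ) * (k / n) ≤ 1 / 10 := by
    rw [← mul_div_assoc, div_le_iff₀ hn0]; nlinarith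
  calc 9 / 10 * (n : ℝ) ^ k ≤ (1 + -(k / n : ℝ)) ^ k * n ^ k := by gcongr; linarith
    _ = (n * (1 + -(k / n : ℝ))) ^ k := by rw [mul_pow, mul_comm]
    _ ≤ _ := pow_le_pow_left₀ (mul_nonneg hn0.le (by linarith)) h3 k

/-- Every colouring has a colour class containing a robust core. -/
lemma exists_monochromatic_core {r : ℕ} (hk : 0 < k) (hn : 10 * (k : ℝ) ^ 2 ≤ n)
    (χ : Finset (Fin n) → Fin r) : ∃ (c : Fin r) (T : Finset (Fin k → Fin n)),
      (∀ x ∈ T, Function.Injective x) ∧ (∀ x ∈ T, χ (univ.image x) = c) ∧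
      IsCore (1 / (8 * k * r)) T ∧ (1 / (8 * k * r) : ℝ) ^ k * n ^ k ≤ T.card ∧
      9 * (n : ℝ) * shadowCard T ≤ 20 * k * r * T.card ∧ T.Nonempty := by
  have hk1 : (1 : ℝ) ≤ k := by exact_mod_cast hk
  have hn0 : (0 : ℝ) < n := by nlinarith
  have hr : 0 < r := Fin.pos (χ ∅)
  have hr0 : (0 : ℝ) < r := by exact_mod_cast hr
  obtain ⟨c, hc⟩ : ∃ c : Fin r, 9 / 10 * (n : ℝ) ^ k ≤
      r * ((univ.filter fun x : Fin k → Fin n => Function.Injective x).filter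
        fun x => χ (univ.image x) = c).card := by
    have h1 := card_eq_sum_card_fiberwise (f := fun x : Fin k → Fin n => χ (univ.image x))
      (s := univ.filter fun x : Fin k → Fin n => Function.Injective x) (t := univ)
      (by intro x _; simp)
    have h2 := card_filter_injective_ge hn hk
    rw [h1] at h2
    push_cast at h2
    by_contra! h
    have h3 := Finset.sum_lt_sum_of_nonempty (s := (univ : Finset (Fin r))) ⟨⟨0, hr⟩, mem_univ _⟩
      (fun c _ => h c)
    rw [← mul_sum, sum_const, card_univ, Fintype.card_fin, nsmul_eq_mul] at h3
    exact absurd h2 (not_le.2 (lt_of_mul_lt_mul_left h3 hr0.le))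
  set X := (univ.filter fun x : Fin k → Fin n => Function.Injective x).filter
    fun x => χ (univ.image x) = c with hX
  have hnk : (0 : ℝ) < (n : ℝ) ^ k := by positivity
  have hXne : X.Nonempty := by
    rw [nonempty_iff_ne_empty]
    intro h
    rw [h] at hc
    simp at hc
    linarith
  obtain ⟨T, hTX, hTne, h1, h2, h3⟩ := exists_core hk hXne
  have hpow : (n : ℝ) ^ k = n * n ^ (k - 1) := by
    rw [← pow_succ', Nat.sub_add_cancel hk]
  have hnk1 : (0 : ℝ) < (n : ℝ) ^ (k - 1) := by positivity
  have hline : ∀ x ∈ T, ∀ i, (1 / (8 * k * r) : ℝ) * n ≤ (line T i x).card := by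
    intro x hx i
    have h4 := mul_le_mul_of_nonneg_left (h2 x hx i) hr0.le
    have h5 : 9 / 10 * (n : ℝ) * n ^ (k - 1) ≤
        r * (4 * k * (line T i x).card) * n ^ (k - 1) := by
      rw [hpow] at hc; nlinarith
    have h6 := le_of_mul_le_mul_right h5 hnk1
    rw [div_mul_eq_mul_div, div_le_iff₀ (by positivity)]
    nlinarith
  refine ⟨c, T, fun x hx => ?_, fun x hx => ?_, ⟨hline, h3⟩, ?_, ?_, hTne⟩
  · exact (mem_filter.1 (mem_filter.1 (hTX hx)).1).2
  · exact (mem_filter.1 (hTX hx)).2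
  · obtain ⟨x, hx⟩ := hTne
    rw [← mul_pow]
    refine (pow_le_card_step (T := T) (x := x) (by positivity) ∅ (by simpa using hline) hx).trans ?_
    refine Nat.cast_le.2 (card_le_card fun y hy => ?_)
    exact (mem_filter.1 hy).2.1.right
  · have h4 := mul_le_mul_of_nonneg_left h1 hr0.le
    have h5 := mul_le_mul_of_nonneg_right hc (Nat.cast_nonneg (α := ℝ) (shadowCard T))
    have h6 : 9 * (n : ℝ) * shadowCard T * n ^ (k - 1) ≤ 20 * k * r * T.card * n ^ (k - 1) := by
      rw [hpow] at h5; nlinarith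
    exact le_of_mul_le_mul_right h6 hnk1

lemma packing_bound {N R κ p f K D D₁ τ τ₁ e : ℝ} (hN : 0 < N) (hR : 0 < R) (hκ : 0 < κ)
    (hp : 0 ≤ p) (hf : 0 ≤ f) (hK : 0 ≤ K) (hD : 0 < D) (hD₁ : D₁ ≤ D)
    (h1 : 9 * N * D ≤ 20 * κ * R * τ) (h2 : 3 * (τ₁ - e) ≤ 4 * (p * (f + K)) * D₁)
    (h3 : 19 / 20 * τ ≤ τ₁ - e) (h4 : 20 * κ * p * K * R ≤ N) :
    27 * N ≤ 100 * R * (κ * (p * f)) := by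
  have h5 : 4 * (p * (f + K)) * D₁ ≤ 4 * (p * (f + K)) * D := by gcongr
  have h6 : 57 / 20 * τ ≤ 4 * (p * (f + K)) * D := by linarith
  have h7 := mul_le_mul_of_nonneg_left h6 (show 0 ≤ κ * R by positivity)
  have h8 : 513 / 20 * N * D ≤ (80 * R * κ * p * f + 80 * R * κ * p * K) * D := by
    nlinarith
  have h9 := le_of_mul_le_mul_right h8 hD
  nlinarith

open Filter in
/-- Every colouring contains a long monochromatic path with a hub and two joining sets. -/
lemma exists_structure (hk : 0 < k) {r : ℕ} (hr : 0 < r) {ψ : ℝ} (hψ : 0 < ψ) :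
    ∃ M : ℕ, ∀ᶠ n : ℕ in atTop, ∀ χ : Finset (Fin n) → Fin r,
      ∃ (c : Fin r) (T : Finset (Fin k → Fin n)) (P B : List (Fin k → Fin n))
        (Z Z' : Finset (Fin n)),
        (∀ x ∈ T, χ (univ.image x) = c) ∧ Joins T M Z ∧ Joins T M Z' ∧
        List.IsChain (Step T) P ∧ (∀ x ∈ P, x ∈ T) ∧ (verts P).Nodup ∧
        (∀ x ∈ B, ∀ y ∈ B, Step T x y) ∧ B.length = 2 * M + 2 ∧ (verts B).Nodup ∧
        (∀ v ∈ verts P, v ∉ verts B) ∧ (∀ v ∈ verts P, v ∉ Z) ∧ (∀ v ∈ verts P, v ∉ Z') ∧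
        (∀ v ∈ verts B, v ∉ Z) ∧ (∀ v ∈ verts B, v ∉ Z') ∧ Disjoint Z Z' ∧
        22 * (n : ℝ) ≤ 100 * r * (k * P.length) ∧ 100 * r * (k * P.length) ≤ 23 * (n : ℝ) ∧
        100 * r * (Z.card + Z'.card + k * B.length : ℝ) ≤ ψ * n := by
  have hk1 : (1 : ℝ) ≤ k := by exact_mod_cast hk
  have hk0 : (0 : ℝ) < k := by linarith
  have hr1 : (1 : ℝ) ≤ r := by exact_mod_cast hr
  have hr0 : (0 : ℝ) < r := by linarith
  set δ : ℝ := 1 / (8 * k * r) with hδ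
  have hδ0 : 0 < δ := by positivity
  set σ : ℝ := δ ^ k with hσ
  have hσ0 : 0 < σ := by positivity
  obtain ⟨M, hres⟩ := exists_reservoirs (k := k) hk hδ0
  obtain ⟨θ, hθ, K, hpack⟩ := exists_packing (k := k) hk (ε := σ / 80) (by positivity)
  obtain ⟨η, hη0, hη1, hη2⟩ : ∃ η : ℝ, 0 < η ∧ k * η < θ ∧ 20 * k * η * K * r ≤ 1 := by
    refine ⟨min (θ / (2 * k)) (1 / (20 * k * (K + 1) * r)), by positivity, ?_, ?_⟩
    · have h := min_le_left (θ / (2 * k)) (1 / (20 * k * (K + 1) * r : ℝ))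
      rw [le_div_iff₀ (by positivity)] at h
      linarith
    · have h := min_le_right (θ / (2 * k)) (1 / (20 * k * (K + 1) * r : ℝ))
      have h0 : 0 < min (θ / (2 * k)) (1 / (20 * k * (K + 1) * r : ℝ)) := by positivity
      rw [le_div_iff₀ (by positivity)] at h
      have : 0 ≤ min (θ / (2 * k)) (1 / (20 * k * (K + 1) * r : ℝ)) * (k * r) := by positivity
      linarith
  set q := ⌈2 / η⌉₊ with hq
  obtain ⟨ζ, hζ0, hζ1, hζ2⟩ : ∃ ζ : ℝ, 0 < ζ ∧ 80 * (k * ζ) ≤ σ ∧ 200 * r * ζ ≤ ψ := by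
    refine ⟨min (σ / (80 * k)) (ψ / (200 * r)), by positivity, ?_, ?_⟩
    · have h := min_le_left (σ / (80 * k)) (ψ / (200 * r))
      rw [le_div_iff₀ (by positivity)] at h
      linarith
    · have h := min_le_right (σ / (80 * k)) (ψ / (200 * r))
      rw [le_div_iff₀ (by positivity)] at h
      linarith
  obtain ⟨n₁, hres⟩ := hres (q + 2) ζ hζ0
  set t := 2 * M + 2 with ht
  obtain ⟨n₂, hhub⟩ := exists_hub k t (δ := σ / 2) (by positivity)
  have hlarge : ∀ C : ℝ, ∀ᶠ n : ℕ in atTop, C ≤ n := fun C =>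
    tendsto_natCast_atTop_atTop.eventually_ge_atTop C
  refine ⟨M, ?_⟩
  filter_upwards [eventually_ge_atTop n₁, eventually_ge_atTop n₂, hlarge (2 / η),
    hlarge (80 * k * (k * t) / σ), hlarge (10 * (k : ℝ) ^ 2), hlarge (200 * r * (k * t) / ψ),
    hlarge (100 * r * k)] with n hn₁ hn₂ hnη hnt hnk hnψ hnr χ
  have hn0 : (0 : ℝ) < n := by nlinarith
  rw [div_le_iff₀ (by positivity)] at hnη hnt hnψ
  obtain ⟨c, T, hTinj, hTc, hcore, hTcard, hTshadow, hTne⟩ := exists_monochromatic_core hk hnk χ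
  obtain ⟨Z, hZd, hZcard, hZJ⟩ := hres n hn₁ T hcore
  set U₀ := (range (q + 2)).biUnion Z with hU₀
  have hZU : ∀ a < q + 2, Z a ⊆ U₀ := fun a ha =>
    subset_biUnion_of_mem Z (mem_range.2 ha)
  have hpow : (n : ℝ) ^ k = n * n ^ (k - 1) := by rw [← pow_succ', Nat.sub_add_cancel hk]
  have hpos : (0 : ℝ) < (n : ℝ) ^ (k - 1) := by positivity
  have hD : (shadowCard T : ℝ) ≤ k * n ^ (k - 1) := by exact_mod_cast shadowCard_le T
  have hD0 : (0 : ℝ) < shadowCard T := by exact_mod_cast shadowCard_pos hk hTne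
  have hNk : (0 : ℝ) < σ * (n : ℝ) ^ k := by positivity
  have havoid : ∀ (U : Finset (Fin n)) (b : ℝ), (U.card : ℝ) * k ≤ b * n →
      (T.card : ℝ) - b * n ^ k ≤ (T.filter fun x => ∀ i, x i ∉ U).card := by
    intro U b hU
    have h1 : (T.card : ℝ) ≤ (T.filter fun x => ∀ i, x i ∉ U).card + U.card * shadowCard T := by
      exact_mod_cast card_le_card_avoid T U
    have h2 : (U.card : ℝ) * shadowCard T ≤ b * n ^ k := by
      calc (U.card : ℝ) * shadowCard T ≤ U.card * (k * n ^ (k - 1)) := by gcongr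
        _ = U.card * k * n ^ (k - 1) := by ring
        _ ≤ b * n * n ^ (k - 1) := by gcongr
        _ = b * n ^ k := by rw [hpow]; ring
    linarith
  have hU₀k : (U₀.card : ℝ) * k ≤ σ / 80 * n := by
    have h1 := mul_le_mul_of_nonneg_right hZcard hk0.le
    have h2 := mul_le_mul_of_nonneg_right hζ1 hn0.le
    linarith
  obtain ⟨B, hBlen, hB, hBnd⟩ := hhub n hn₂ (T.filter fun x => ∀ i, x i ∉ U₀)
    (fun x hx => hTinj x (mem_filter.1 hx).1) (by
      have := havoid U₀ _ hU₀k
      linarith)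
  have hBU : ∀ v ∈ verts B, v ∉ U₀ := by
    intro v hv
    obtain ⟨x, hx, i, rfl⟩ := mem_verts.1 hv
    exact (mem_filter.1 (hB x hx x hx).left).2 i
  have hBcard : (verts B).toFinset.card = k * t := by
    rw [List.toFinset_card_of_nodup hBnd, length_verts, hBlen]
  set U := U₀ ∪ (verts B).toFinset with hU
  have hUk : (U.card : ℝ) * k ≤ σ / 40 * n := by
    have h1 : (U.card : ℝ) ≤ U₀.card + k * t := by
      have := card_union_le U₀ (verts B).toFinset
      rw [hBcard] at this
      exact_mod_cast this
    have h2 := mul_le_mul_of_nonneg_right h1 hk0.le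
    linarith
  set T₁ := T.filter fun x => ∀ i, x i ∉ U with hT₁
  have hT₁card := havoid U _ hUk
  rw [← hT₁] at hT₁card
  have hT₁ne : T₁.Nonempty := by
    rw [← card_pos]
    have : (0 : ℝ) < T₁.card := by linarith
    exact_mod_cast this
  set p := ⌊η * n⌋₊ with hp
  have hp1 : (p : ℝ) ≤ η * n := Nat.floor_le (by positivity)
  have hp2 : η * n < p + 1 := Nat.lt_floor_add_one _
  have hp3 : (1 : ℝ) ≤ p := by
    have : 1 ≤ p := Nat.le_floor (by push_cast; linarith)
    exact_mod_cast this
  obtain ⟨F, hF, hFnd, hFcard⟩ := hpack n T₁ hT₁ne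
    (fun x hx => hTinj x (mem_filter.1 hx).1) p (by exact_mod_cast hp3) (by
      have h1 := mul_le_mul_of_nonneg_left hp1 hk0.le
      have h2 := mul_lt_mul_of_pos_right hη1 hn0
      linarith)
  have hFlen : F.flatten.length = p * F.length := by
    rw [List.length_flatten, List.map_congr_left (g := fun _ => p) fun L hL => (hF L hL).1]
    simp [mul_comm]
  have hFU : ∀ v ∈ verts F.flatten, v ∉ U := by
    intro v hv
    obtain ⟨x, hx, i, rfl⟩ := mem_verts.1 hv
    obtain ⟨L, hL, hxL⟩ := List.mem_flatten.1 hx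
    exact (mem_filter.1 ((hF L hL).2.2 x hxL)).2 i
  have hFq : F.length ≤ q := by
    have h1 : (k : ℝ) * (p * F.length) ≤ n := by
      have := hFnd.length_le_card
      rw [length_verts, hFlen, Fintype.card_fin] at this
      exact_mod_cast this
    have h2 : (p : ℝ) * F.length ≤ n := le_trans (le_mul_of_one_le_left (by positivity) hk1) h1
    have h3 : (F.length : ℝ) * η * n ≤ 2 * n := by
      have h4 : η * n ≤ 2 * p := by linarith
      have h5 := mul_le_mul_of_nonneg_right h4 (Nat.cast_nonneg (α := ℝ) F.length)
      linarith
    have h4 : (F.length : ℝ) ≤ 2 / η := by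
      rw [le_div_iff₀ hη0]
      exact le_of_mul_le_mul_right h3 hn0
    exact_mod_cast h4.trans (Nat.le_ceil _)
  have hlong : 27 * (n : ℝ) ≤ 100 * r * (k * (p * F.length)) := by
    refine packing_bound (K := K) (D₁ := shadowCard T₁) (τ := T.card) hn0 hr0 hk0 (by positivity)
      (by positivity) (by positivity) hD0 ?_ hTshadow hFcard ?_ ?_
    · exact_mod_cast shadowCard_mono (filter_subset _ _)
    · linarith
    · have h1 := mul_le_mul_of_nonneg_left hp1 (show (0 : ℝ) ≤ 20 * k * K * r by positivity)
      have h2 := mul_le_mul_of_nonneg_right hη2 hn0.le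
      linarith
  obtain ⟨P, hP, hPT, hPnd, hPlen, hPv⟩ := exists_long_path hZd
    (fun a ha => hZJ a (lt_trans ha (by omega))) F hFq
    (fun L hL => ⟨(hF L hL).2.1.imp fun _ _ h => h.mono (filter_subset _ _),
      fun x hx => (mem_filter.1 ((hF L hL).2.2 x hx)).1⟩) hFnd
    (fun v hv a ha h => hFU v hv (mem_union_left _ (hZU a (by omega) h)))
  set l := ⌊23 * n / (100 * r * k : ℝ)⌋₊ with hl
  have hl1 : 100 * r * (k * l) ≤ 23 * (n : ℝ) := by
    have : (l : ℝ) ≤ 23 * n / (100 * r * k : ℝ) := Nat.floor_le (by positivity)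
    rw [le_div_iff₀ (by positivity)] at this
    linarith
  have hl2 : 22 * (n : ℝ) ≤ 100 * r * (k * l) := by
    have : 23 * n / (100 * r * k : ℝ) < l + 1 := Nat.lt_floor_add_one _
    rw [div_lt_iff₀ (by positivity)] at this
    linarith
  have hlP : (P.take l).length = l := by
    rw [List.length_take]
    refine min_eq_left (le_trans ?_ hPlen)
    rw [hFlen]
    have h1 : 100 * r * k * (l : ℝ) ≤ 100 * r * k * (p * F.length) := by linarith
    have h2 := le_of_mul_le_mul_left h1 (by positivity)
    exact_mod_cast h2
  have hsub : ∀ v ∈ verts (P.take l), v ∈ verts P := fun v hv =>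
    (verts_sublist (List.take_sublist _ _)).subset hv
  have hPZ : ∀ a, q ≤ a → a < q + 2 → ∀ v ∈ verts (P.take l), v ∉ Z a := by
    intro a ha ha' v hv h
    rcases hPv v (hsub v hv) with h1 | ⟨b, hb, h1⟩
    · exact hFU v h1 (mem_union_left _ (hZU a ha' h))
    · exact disjoint_left.1 (hZd a b (by omega)) h h1
  refine ⟨c, T, P.take l, B, Z q, Z (q + 1), hTc, hZJ q (by omega), hZJ (q + 1) (by omega),
    hP.take _, fun x hx => hPT x (List.mem_of_mem_take hx),
    hPnd.sublist (verts_sublist (List.take_sublist _ _)),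
    fun x hx y hy => (hB x hx y hy).mono (filter_subset _ _), hBlen, hBnd, ?_,
    hPZ q le_rfl (by omega), hPZ (q + 1) (by omega) (by omega),
    fun v hv h => hBU v hv (hZU q (by omega) h), fun v hv h => hBU v hv (hZU (q + 1) (by omega) h),
    hZd _ _ (by omega), by rwa [hlP], by rwa [hlP], ?_⟩
  · intro v hv h
    rcases hPv v (hsub v hv) with h1 | ⟨b, hb, h1⟩
    · exact hFU v h1 (mem_union_right _ (List.mem_toFinset.2 h))
    · exact hBU v h (hZU b (by omega) h1)
  · have h1 : ((Z q).card : ℝ) + (Z (q + 1)).card ≤ U₀.card := by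
      have h := card_le_card (union_subset (hZU q (by omega)) (hZU (q + 1) (by omega)))
      rw [card_union_of_disjoint (hZd _ _ (by omega))] at h
      exact_mod_cast h
    rw [hBlen]
    have h2 := mul_le_mul_of_nonneg_left (h1.trans hZcard) (show (0 : ℝ) ≤ 200 * r by positivity)
    have h3 := mul_le_mul_of_nonneg_right hζ2 hn0.le
    linarith

end TightReservoir

theorem tight_cycle_reservoir (k r : ℕ) (hk : 3 ≤ k) :
    ∃ ψ₀ : ℝ, 0 < ψ₀ ∧ ∀ ψ : ℝ, 0 < ψ → ψ ≤ ψ₀ →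
      ∃ n₀ : ℕ, ∀ n : ℕ, n₀ ≤ n → ∀ χ : Finset (Fin n) → Fin r,
        ∃ W : Finset (Fin n),
          (n : ℝ) / (5 * r) ≤ W.card ∧ (W.card : ℝ) ≤ n / (4 * r) ∧
          ∀ ℓ : ℕ, k ∣ ℓ → (ℓ : ℝ) ≤ (1 - ψ) * W.card →
            ∃ C : Finset (Fin n), C ⊆ W ∧ C.card = ℓ ∧ MonoTightCycle k χ C := by
  open TightReservoir in
  refine ⟨1, one_pos, fun ψ hψ hψ1 => ?_⟩
  rcases Nat.eq_zero_or_pos r with rfl | hr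
  · exact ⟨0, fun n _ χ => (χ ∅).elim0⟩
  have hk0 : 0 < k := by omega
  have hr0 : (0 : ℝ) < r := by exact_mod_cast hr
  obtain ⟨M, h⟩ := exists_structure hk0 hr hψ
  obtain ⟨n₀, h⟩ := Filter.eventually_atTop.1 h
  refine ⟨n₀, fun n hn χ => ?_⟩
  obtain ⟨c, T, P, B, Z, Z', hTc, hZ, hZ', hP, hPT, hPnd, hB, hBlen, hBnd, hPB, hPZ, hPZ', hBZ,
    hBZ', hZZ', hlow, hupp, hsmall⟩ := h n hn χ
  set W := (verts P).toFinset ∪ ((verts B).toFinset ∪ (Z ∪ Z')) with hW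
  have hPcard : (verts P).toFinset.card = k * P.length := by
    rw [List.toFinset_card_of_nodup hPnd, length_verts]
  have hBcard : (verts B).toFinset.card = k * B.length := by
    rw [List.toFinset_card_of_nodup hBnd, length_verts]
  have hW1 : (k * P.length : ℝ) ≤ W.card := by
    have := Finset.card_le_card (Finset.subset_union_left : (verts P).toFinset ⊆ W)
    rw [hPcard] at this
    exact_mod_cast this
  have hW2 : (W.card : ℝ) ≤ k * P.length + (Z.card + Z'.card + k * B.length) := by
    have h1 := Finset.card_union_le (verts P).toFinset ((verts B).toFinset ∪ (Z ∪ Z'))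
    have h2 := Finset.card_union_le (verts B).toFinset (Z ∪ Z')
    have h3 := Finset.card_union_le Z Z'
    rw [hPcard, ← hW] at h1
    rw [hBcard] at h2
    have : W.card ≤ k * P.length + (Z.card + Z'.card + k * B.length) := by omega
    exact_mod_cast this
  have hn0 : (0 : ℝ) ≤ n := Nat.cast_nonneg n
  have hψn : ψ * n ≤ n := mul_le_of_le_one_left hn0 hψ1
  have hW1' := mul_le_mul_of_nonneg_left hW1 hr0.le
  have hW2' := mul_le_mul_of_nonneg_left hW2 hr0.le
  refine ⟨W, ?_, ?_, ?_⟩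
  · rw [div_le_iff₀ (by positivity)]
    linarith
  · rw [le_div_iff₀ (by positivity)]
    linarith
  · rintro _ ⟨m, rfl⟩ hm
    rcases Nat.eq_zero_or_pos m with rfl | hm0
    · exact ⟨∅, by simp, by simp, Or.inl (by simp)⟩
    have hmP : m ≤ P.length := by
      have h1 : 100 * r * (ψ * W.card) ≥ ψ * n := by
        have := mul_le_mul_of_nonneg_left hW1' hψ.le
        have := mul_le_mul_of_nonneg_left hlow hψ.le
        nlinarith
      have h2 : 100 * r * k * (m : ℝ) ≤ 100 * r * k * P.length := by
        push_cast at hm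
        have := mul_le_mul_of_nonneg_left hm hr0.le
        linarith
      have hk1 : (0 : ℝ) < k := by exact_mod_cast hk0
      have h3 := le_of_mul_le_mul_left h2 (by positivity)
      exact_mod_cast h3
    obtain ⟨x, L, hL, hchain, hnd, hv⟩ := exists_closed_walk hZ hZ' hP hPT hPnd hB hBlen hBnd hPB
      hPZ hPZ' hBZ hBZ' hZZ' hm0 hmP
    obtain ⟨hcard, hmono⟩ := monoTightCycle_of_isChain hk0 hTc hchain hnd
    refine ⟨_, fun v hvC => ?_, by rw [hcard, hL], hmono⟩
    have := hv v (List.mem_toFinset.1 hvC)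
    simpa [hW] using this
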